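/- arXiv:2509.07086 — 3 statements merged into one kernel-verified Lean document; each statement's English description precedes it below -/
import Mathlib

section
/- Let ρc be a positive semidefinite matrix indexed by Fin 3 × Fin 3 over ℂ that is PPT, has matrix rank 4, and is entangled (not separable, i.e. ¬(SN(ρc) ≤ 1)). Then ρc is unextendible: for every PPT (1,0)-local extension ρ of ρc — a positive semidefinite, PPT matrix indexed by Fin 4 × Fin 3 whose compression to index pairs (i,j) with i < 3 equals ρc, with off-diagonal block χ given by χ((i,j),l) = ρ((i,j),(3,l)) for i < 3 — there exists φ ∈ ℂ^3 such that χ y = ρc (φ ⊗ y) for every y ∈ ℂ^3 (the SLOCC-trivial form of the off-diagonal block). -/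
open Matrix Kronecker ComplexOrder

/-- The Schmidt rank of a vector `ψ ∈ ℂ^(Fin m × Fin n)`: the rank of the associated
`m × n` matrix with `(i,j)` entry `ψ (i,j)`. -/
noncomputable def schmidtRank {m n : ℕ} (ψ : Fin m × Fin n → ℂ) : ℕ :=
  (Matrix.of fun i j => ψ (i, j) : Matrix (Fin m) (Fin n) ℂ).rank

/-- Rank-one outer product `v v*`. -/
def outer {d : Type*} (v : d → ℂ) : Matrix d d ℂ :=
  Matrix.of fun a b => v a * star (v b)

/-- `SNle ρ k` : the Schmidt number of `ρ` is at most `k`, i.e. `ρ` is a finite sum of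
outer products of vectors of Schmidt rank at most `k`. -/
def SNle {m n : ℕ} (ρ : Matrix (Fin m × Fin n) (Fin m × Fin n) ℂ) (k : ℕ) : Prop :=
  ∃ (T : ℕ) (v : Fin T → (Fin m × Fin n → ℂ)),
    (∀ t, schmidtRank (v t) ≤ k) ∧ ρ = ∑ t, outer (v t)

/-- Partial transpose on the second (B) subsystem. -/
def ptB {m n : ℕ} (ρ : Matrix (Fin m × Fin n) (Fin m × Fin n) ℂ) :
    Matrix (Fin m × Fin n) (Fin m × Fin n) ℂ :=
  Matrix.of fun p q => ρ (p.1, q.2) (q.1, p.2)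

/-- Partial transpose on the first (A) subsystem. -/
def ptA {m n : ℕ} (ρ : Matrix (Fin m × Fin n) (Fin m × Fin n) ℂ) :
    Matrix (Fin m × Fin n) (Fin m × Fin n) ℂ :=
  Matrix.of fun p q => ρ (q.1, p.2) (p.1, q.2)


set_option linter.unusedSectionVars false


/-- partial transpose -/
def pt {α β : Type} (ρ : Matrix (α × β) (α × β) ℂ) : Matrix (α × β) (α × β) ℂ :=
  Matrix.of fun p q => ρ (p.1, q.2) (q.1, p.2)

def pv {α β : Type} (a : α → ℂ) (b : β → ℂ) : α × β → ℂ := fun p => a p.1 * b p.2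

def Sepa {α β : Type} (ρ : Matrix (α × β) (α × β) ℂ) : Prop :=
  ρ ∈ AddSubmonoid.closure {M | ∃ (a : α → ℂ) (b : β → ℂ), M = outer (pv a b)}

def PPT {α β : Type} (ρ : Matrix (α × β) (α × β) ℂ) : Prop :=
  ρ.PosSemidef ∧ (pt ρ).PosSemidef

/-- local transformation -/
noncomputable def ltr {α β α' β' : Type} [Fintype α] [Fintype β]
    (S : Matrix α α' ℂ) (T : Matrix β β' ℂ) (ρ : Matrix (α × β) (α × β) ℂ) :
    Matrix (α' × β') (α' × β') ℂ := (S ⊗ₖ T)ᴴ * ρ * (S ⊗ₖ T)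

section gen
variable {α β α' β' α'' β'' : Type}

lemma pt_pt (ρ : Matrix (α × β) (α × β) ℂ) : pt (pt ρ) = ρ := by
  ext p q; simp [pt]

lemma pt_add (ρ σ : Matrix (α × β) (α × β) ℂ) : pt (ρ + σ) = pt ρ + pt σ := by
  ext p q; simp [pt]

lemma pt_sub (ρ σ : Matrix (α × β) (α × β) ℂ) : pt (ρ - σ) = pt ρ - pt σ := by
  ext p q; simp [pt]

lemma pt_smul (c : ℂ) (ρ : Matrix (α × β) (α × β) ℂ) : pt (c • ρ) = c • pt ρ := by
  ext p q; simp [pt]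

lemma pt_herm {ρ : Matrix (α × β) (α × β) ℂ} (h : ρ.IsHermitian) : (pt ρ).IsHermitian := by
  ext p q
  simp only [pt, conjTranspose_apply, of_apply]
  exact h.apply _ _

lemma PPT.pt {ρ : Matrix (α × β) (α × β) ℂ} (h : PPT ρ) : PPT (pt ρ) :=
  ⟨h.2, by rw [pt_pt]; exact h.1⟩

lemma PPT.add {ρ σ : Matrix (α × β) (α × β) ℂ} (h : PPT ρ) (h' : PPT σ) : PPT (ρ + σ) :=
  ⟨h.1.add h'.1, by rw [pt_add]; exact h.2.add h'.2⟩

lemma pt_outer (a : α → ℂ) (b : β → ℂ) : _root_.pt (outer (pv a b)) = outer (pv a (star b)) := by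
  ext p q
  simp [_root_.pt, outer, pv]; ring

lemma outer_psd {d : Type} [Fintype d] (v : d → ℂ) : (outer v).PosSemidef :=
  posSemidef_vecMulVec_self_star v

lemma PPT.outer [Fintype α] [Fintype β] (a : α → ℂ) (b : β → ℂ) : PPT (outer (pv a b)) :=
  ⟨outer_psd _, by rw [pt_outer]; exact outer_psd _⟩

lemma sep_outer (a : α → ℂ) (b : β → ℂ) : Sepa (outer (pv a b)) :=
  AddSubmonoid.subset_closure ⟨a, b, rfl⟩

lemma Sepa.add {ρ σ : Matrix (α × β) (α × β) ℂ} (h : Sepa ρ) (h' : Sepa σ) : Sepa (ρ + σ) :=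
  AddSubmonoid.add_mem _ h h'

lemma Sepa.map {ρ : Matrix (α × β) (α × β) ℂ} (h : Sepa ρ)
    (f : Matrix (α × β) (α × β) ℂ →+ Matrix (α' × β') (α' × β') ℂ)
    (hf : ∀ a b, Sepa (f (_root_.outer (pv a b)))) : Sepa (f ρ) := by
  induction h using AddSubmonoid.closure_induction with
  | mem x hx => obtain ⟨a, b, rfl⟩ := hx; exact hf a b
  | zero => rw [map_zero]; exact AddSubmonoid.zero_mem _
  | add x y _ _ hx hy => rw [map_add]; exact hx.add hy

lemma Sepa.pt {ρ : Matrix (α × β) (α × β) ℂ} (h : Sepa ρ) : Sepa (pt ρ) :=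
  h.map ⟨⟨_root_.pt, by ext; simp [_root_.pt]⟩, pt_add⟩ fun a b => by
    change Sepa (_root_.pt _)
    rw [pt_outer]; exact sep_outer _ _

lemma sep_of_pt {ρ : Matrix (α × β) (α × β) ℂ} (h : Sepa (_root_.pt ρ)) : Sepa ρ := by
  have := h.pt; rwa [pt_pt] at this

/-- swap of the two factors -/
def sw (ρ : Matrix (α × β) (α × β) ℂ) : Matrix (β × α) (β × α) ℂ :=
  ρ.submatrix Prod.swap Prod.swap

lemma Sepa.sw {ρ : Matrix (α × β) (α × β) ℂ} (h : Sepa ρ) : Sepa (sw ρ) :=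
  h.map ⟨⟨_root_.sw, by ext; simp [_root_.sw]⟩, fun _ _ => rfl⟩ fun a b => by
    change Sepa (_root_.sw _)
    have : _root_.sw (_root_.outer (pv a b)) = _root_.outer (pv b a) := by
      ext p q; simp [_root_.sw, _root_.outer, pv]; ring
    rw [this]; exact sep_outer _ _

lemma sep_of_sw {ρ : Matrix (α × β) (α × β) ℂ} (h : Sepa (_root_.sw ρ)) : Sepa ρ := h.sw

lemma PPT.sw {ρ : Matrix (α × β) (α × β) ℂ} (h : PPT ρ) : PPT (sw ρ) := by
  refine ⟨h.1.submatrix _, ?_⟩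
  exact (h.2.submatrix Prod.swap).transpose

lemma outer_mul {d e : Type} [Fintype d] (v : d → ℂ) (A : Matrix d e ℂ) :
    Aᴴ * outer v * A = outer (Aᴴ *ᵥ v) := by
  have : ∀ {d : Type} (v : d → ℂ), outer v = vecMulVec v (star v) := fun v => by
    ext; simp [outer, vecMulVec]
  rw [this, this, mul_vecMulVec, vecMulVec_mul, star_mulVec, conjTranspose_conjTranspose]

variable [Fintype α] [Fintype β] [Fintype α'] [Fintype β'] 

lemma ltr_apply (S : Matrix α α' ℂ) (T : Matrix β β' ℂ) (ρ : Matrix (α × β) (α × β) ℂ) (p q) :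
    ltr S T ρ p q = ∑ x : (α × β) × (α × β), star (S x.1.1 p.1 * T x.1.2 p.2) * ρ x.1 x.2 *
      (S x.2.1 q.1 * T x.2.2 q.2) := by
  rw [Fintype.sum_prod_type_right]
  simp [ltr, mul_apply, Finset.sum_mul]

lemma pt_ltr (S : Matrix α α' ℂ) (T : Matrix β β' ℂ) (ρ : Matrix (α × β) (α × β) ℂ) :
    pt (ltr S T ρ) = ltr S (T.map star) (pt ρ) := by
  ext p q
  simp only [pt, of_apply, ltr_apply]
  let e : (α × β) × (α × β) ≃ (α × β) × (α × β) :=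
    ⟨fun x => ((x.1.1, x.2.2), (x.2.1, x.1.2)), fun x => ((x.1.1, x.2.2), (x.2.1, x.1.2)),
      fun x => rfl, fun x => rfl⟩
  rw [← Equiv.sum_comp e]
  refine Finset.sum_congr rfl fun x _ => ?_
  simp [e]; ring

lemma PPT.ltr {ρ : Matrix (α × β) (α × β) ℂ} (h : PPT ρ) (S : Matrix α α' ℂ) (T : Matrix β β' ℂ) :
    PPT (ltr S T ρ) :=
  ⟨h.1.conjTranspose_mul_mul_same _, by rw [pt_ltr]; exact h.2.conjTranspose_mul_mul_same _⟩

lemma kron_pv (S : Matrix α α' ℂ) (T : Matrix β β' ℂ) (a : α' → ℂ) (b : β' → ℂ) :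
    (S ⊗ₖ T) *ᵥ (pv a b) = pv (S *ᵥ a) (T *ᵥ b) := by
  ext p
  simp only [mulVec, dotProduct, pv, kroneckerMap_apply, Finset.sum_mul_sum,
    Fintype.sum_prod_type]
  refine Finset.sum_congr rfl fun x _ => Finset.sum_congr rfl fun y _ => by ring

lemma Sepa.ltr {ρ : Matrix (α × β) (α × β) ℂ} (h : Sepa ρ) (S : Matrix α α' ℂ) (T : Matrix β β' ℂ) :
    Sepa (ltr S T ρ) :=
  h.map ⟨⟨_root_.ltr S T, by simp [_root_.ltr]⟩, fun _ _ => by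
    simp [_root_.ltr, Matrix.mul_add, Matrix.add_mul]⟩ fun a b => by
    change Sepa (_root_.ltr S T _)
    rw [_root_.ltr, outer_mul, conjTranspose_kronecker, kron_pv]
    exact sep_outer _ _

lemma rank_ltr_le (S : Matrix α α' ℂ) (T : Matrix β β' ℂ) (ρ : Matrix (α × β) (α × β) ℂ) :
    (ltr S T ρ).rank ≤ ρ.rank :=
  (rank_mul_le_left _ _).trans (rank_mul_le_right _ _)

lemma ltr_ltr (S : Matrix α α' ℂ) (T : Matrix β β' ℂ) (S' : Matrix α' α'' ℂ) (T' : Matrix β' β'' ℂ)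
    (ρ : Matrix (α × β) (α × β) ℂ) : ltr S' T' (ltr S T ρ) = ltr (S * S') (T * T') ρ := by
  simp only [ltr, mul_kronecker_mul, conjTranspose_mul, Matrix.mul_assoc]

lemma ltr_one [DecidableEq α] [DecidableEq β] (ρ : Matrix (α × β) (α × β) ℂ) : ltr 1 1 ρ = ρ := by
  simp [ltr]

lemma sep_of_ltr [DecidableEq α] [DecidableEq β] {S : Matrix α α ℂ} {T : Matrix β β ℂ}
    (hS : IsUnit S) (hT : IsUnit T)
    {ρ : Matrix (α × β) (α × β) ℂ} (h : Sepa (ltr S T ρ)) : Sepa ρ := by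
  have := h.ltr S⁻¹ T⁻¹
  rwa [ltr_ltr, mul_nonsing_inv _ ((isUnit_iff_isUnit_det _).1 hS),
    mul_nonsing_inv _ ((isUnit_iff_isUnit_det _).1 hT), ltr_one] at this

lemma sep_sum {ι : Type} [Fintype ι] {ρ : Matrix (α × β) (α × β) ℂ} (a : ι → α → ℂ)
    (b : ι → β → ℂ) (h : ∀ p q, ρ p q = ∑ t, a t p.1 * b t p.2 * star (a t q.1 * b t q.2)) :
    Sepa ρ := by
  have : ρ = ∑ t, outer (pv (a t) (b t)) := by
    ext p q
    rw [h, Matrix.sum_apply]; rfl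
  rw [this]
  exact AddSubmonoid.sum_mem _ fun t _ => sep_outer _ _

end gen

lemma SNle_of_sep {m n : ℕ} {ρ : Matrix (Fin m × Fin n) (Fin m × Fin n) ℂ} (h : Sepa ρ) :
    SNle ρ 1 := by
  induction h using AddSubmonoid.closure_induction with
  | mem x hx =>
    obtain ⟨a, b, rfl⟩ := hx
    refine ⟨1, fun _ => pv a b, fun _ => ?_, by simp⟩
    exact rank_vecMulVec_le a b
  | zero => exact ⟨0, fun _ => 0, fun t => t.elim0, by simp⟩
  | add x y _ _ hx hy =>
    obtain ⟨T, v, hv, rfl⟩ := hx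
    obtain ⟨T', v', hv', rfl⟩ := hy
    refine ⟨T + T', Fin.append v v', fun t => ?_, by simp [Fin.sum_univ_add]⟩
    induction t using Fin.addCases with
    | left i => simpa using hv i
    | right i => simpa using hv' i


lemma joint_diag {n ι : Type} [Fintype n] [DecidableEq n] (A : ι → Matrix n n ℂ)
    (hA : ∀ i, (A i).IsHermitian) (hc : ∀ i j, Commute (A i) (A j)) :
    ∃ (V : Matrix n n ℂ) (d : ι → n → ℂ), Vᴴ * V = 1 ∧ V * Vᴴ = 1 ∧
      ∀ i, A i = V * diagonal (d i) * Vᴴ := by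
  classical
  let T : ι → (EuclideanSpace ℂ n →ₗ[ℂ] EuclideanSpace ℂ n) := fun i => toEuclideanLin (A i)
  have hT : ∀ i, (T i).IsSymmetric := fun i => isSymmetric_toEuclideanLin_iff.2 (hA i)
  have hTm : ∀ i j, T i * T j = toEuclideanLin (A i * A j) := by
    intro i j
    ext x
    simp [T, toLpLin_apply]
  have hC : Pairwise (Function.onFun Commute T) := by
    intro i j _
    change T i * T j = T j * T i
    rw [hTm, hTm, (hc i j).eq]
  let W : (ι → ℂ) → Submodule ℂ (EuclideanSpace ℂ n) :=
    fun γ => ⨅ j, Module.End.eigenspace (T j) (γ j)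
  have hint : DirectSum.IsInternal W :=
    LinearMap.IsSymmetric.directSum_isInternal_of_pairwise_commute hT hC
  have hort : OrthogonalFamily ℂ (fun γ => W γ) fun γ => (W γ).subtypeₗᵢ :=
    LinearMap.IsSymmetric.orthogonalFamily_iInf_eigenspaces hT
  have hfin : Set.Finite {γ | W γ ≠ ⊥} :=
    WellFoundedGT.finite_ne_bot_of_iSupIndep hint.submodule_iSupIndep
  have : Fintype {γ // W γ ≠ ⊥} := hfin.fintype
  have hint' := (DirectSum.isInternal_ne_bot_iff (A := W)).2 hint
  have hort' : OrthogonalFamily ℂ (fun γ : {γ // W γ ≠ ⊥} => W γ) fun γ => (W γ).subtypeₗᵢ :=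
    hort.comp Subtype.val_injective
  have hn : Module.finrank ℂ (EuclideanSpace ℂ n) = Fintype.card n := by simp
  let b0 := hint'.subordinateOrthonormalBasis hn hort'
  let b := b0.reindex (Fintype.equivFin n).symm
  have hb : ∀ k, ∃ γ : ι → ℂ, ∀ j, T j (b k) = γ j • b k := by
    intro k
    refine ⟨(hint'.subordinateOrthonormalBasisIndex hn ((Fintype.equivFin n) k) hort').1, fun j => ?_⟩
    have := hint'.subordinateOrthonormalBasis_subordinate hn ((Fintype.equivFin n) k) hort'
    have h2 := (Submodule.mem_iInf _).1 this j
    rw [Module.End.mem_eigenspace_iff] at h2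
    simpa [b, b0] using h2
  choose γ hγ using hb
  let V : Matrix n n ℂ := (EuclideanSpace.basisFun n ℂ).toBasis.toMatrix b
  have hVU : V ∈ unitaryGroup n ℂ :=
    (EuclideanSpace.basisFun n ℂ).toMatrix_orthonormalBasis_mem_unitary b
  have hVa : ∀ x k, V x k = b k x := by
    intro x k
    simp [V, Module.Basis.toMatrix]
  have h1 : Vᴴ * V = 1 := (mem_unitaryGroup_iff').1 hVU
  have h2 : V * Vᴴ = 1 := (mem_unitaryGroup_iff).1 hVU
  refine ⟨V, fun i k => γ k i, h1, h2, fun i => ?_⟩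
  have h3 : A i * V = V * diagonal (fun k => γ k i) := by
    ext x k
    rw [mul_diagonal]
    have := congrArg (fun v : EuclideanSpace ℂ n => v x) (hγ k i)
    simp only [T, toLpLin_apply] at this
    simp only [mul_apply, hVa]
    simpa [mulVec, dotProduct, mul_comm] using this
  rw [← h3, Matrix.mul_assoc, h2, Matrix.mul_one]

lemma normal_diag {n ι : Type} [Fintype n] [DecidableEq n] (T : ι → Matrix n n ℂ)
    (h : ∀ i j, (T i)ᴴ * T j = T j * (T i)ᴴ) :
    ∃ (V : Matrix n n ℂ) (d : ι → n → ℂ), Vᴴ * V = 1 ∧ V * Vᴴ = 1 ∧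
      ∀ i, T i = V * diagonal (d i) * Vᴴ := by
  have hcomm : ∀ i j, T i * T j = T j * T i := by
    intro j k
    rw [← sub_eq_zero, ← trace_conjTranspose_mul_self_eq_zero_iff]
    simp only [conjTranspose_sub, conjTranspose_mul, Matrix.sub_mul, Matrix.mul_sub, trace_sub]
    have e1 : trace ((T k)ᴴ * (T j)ᴴ * (T j * T k)) = trace ((T k)ᴴ * T k * ((T j)ᴴ * T j)) := by
      rw [← Matrix.mul_assoc, trace_mul_comm, h k k]; simp only [Matrix.mul_assoc]
    have e2 : (T k)ᴴ * (T j)ᴴ * (T k * T j) = (T k)ᴴ * T k * ((T j)ᴴ * T j) := by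
      rw [Matrix.mul_assoc, ← Matrix.mul_assoc (T j)ᴴ, h j k]; simp only [Matrix.mul_assoc]
    have e3 : trace ((T j)ᴴ * (T k)ᴴ * (T j * T k)) = trace ((T k)ᴴ * T k * ((T j)ᴴ * T j)) := by
      rw [Matrix.mul_assoc, ← Matrix.mul_assoc (T k)ᴴ, h k j, trace_mul_comm ((T k)ᴴ * T k)]
      simp only [Matrix.mul_assoc]
    have e4 : trace ((T j)ᴴ * (T k)ᴴ * (T k * T j)) = trace ((T k)ᴴ * T k * ((T j)ᴴ * T j)) := by
      rw [← Matrix.mul_assoc, trace_mul_comm, trace_mul_comm ((T k)ᴴ * T k), h j j]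
      simp only [Matrix.mul_assoc]
    rw [e1, e2, e3, e4]; ring
  have c1 : ∀ i j, Commute (T i) (T j) := hcomm
  have c2 : ∀ i j, Commute (T i)ᴴ (T j) := h
  have c3 : ∀ i j, Commute (T i)ᴴ (T j)ᴴ := fun i j => by
    have := congrArg conjTranspose (hcomm i j)
    simp only [conjTranspose_mul] at this
    exact this.symm
  have c4 : ∀ i j, Commute (T i) (T j)ᴴ := fun i j => (c2 j i).symm
  let A : ι × Bool → Matrix n n ℂ := fun p =>
    if p.2 then Complex.I • (T p.1 - (T p.1)ᴴ) else T p.1 + (T p.1)ᴴ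
  obtain ⟨V, d, h1, h2, h3⟩ := joint_diag A
    (by
      rintro ⟨i, (_ | _)⟩
      · simp [A, IsHermitian, add_comm]
      · simp [A, IsHermitian, ← smul_neg])
    (by
      have p : ∀ i j, Commute (T i + (T i)ᴴ) (T j + (T j)ᴴ) := fun i j =>
        ((c1 i j).add_right (c4 i j)).add_left ((c2 i j).add_right (c3 i j))
      have m : ∀ i j, Commute (T i - (T i)ᴴ) (T j - (T j)ᴴ) := fun i j =>
        ((c1 i j).sub_right (c4 i j)).sub_left ((c2 i j).sub_right (c3 i j))
      have pm : ∀ i j, Commute (T i + (T i)ᴴ) (T j - (T j)ᴴ) := fun i j =>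
        ((c1 i j).sub_right (c4 i j)).add_left ((c2 i j).sub_right (c3 i j))
      rintro ⟨i, (_ | _)⟩ ⟨j, (_ | _)⟩
      · simpa [A] using p i j
      · simpa [A] using (pm i j).smul_right Complex.I
      · simpa [A] using (pm j i).symm.smul_left Complex.I
      · simpa [A] using ((m i j).smul_right Complex.I).smul_left Complex.I)
  refine ⟨V, fun i k => (d (i, false) k - Complex.I * d (i, true) k) / 2, h1, h2, fun i => ?_⟩
  have hT : T i = (1 / 2 : ℂ) • (A (i, false) - Complex.I • A (i, true)) := by
    simp only [A, if_true, smul_smul, Complex.I_mul_I]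
    ext x y
    simp; ring
  have hd : diagonal (fun k => (d (i, false) k - Complex.I * d (i, true) k) / 2) =
    (1 / 2 : ℂ) • (diagonal (d (i, false)) - Complex.I • diagonal (d (i, true))) := by
    ext x y
    by_cases hxy : x = y
    · subst hxy; simp; ring
    · simp [hxy]
  rw [hT, h3, h3, hd]
  simp only [Matrix.mul_smul, Matrix.smul_mul, Matrix.mul_sub, Matrix.sub_mul]

lemma sep_normal {α β n : Type} [Fintype α] [Fintype β] [Fintype n] [DecidableEq n]
    (T : β → Matrix n n ℂ)
    (h : ∀ i j, (T i)ᴴ * T j = T j * (T i)ᴴ) (e : α → n) {ρ : Matrix (α × β) (α × β) ℂ}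
    (hρ : ∀ i j k l, ρ (i, j) (k, l) = ((T j)ᴴ * T l) (e i) (e k)) : Sepa ρ := by
  obtain ⟨V, d, h1, h2, h3⟩ := normal_diag T h
  refine sep_sum (ι := n) (fun t i => V (e i) t) (fun t j => star (d j t)) ?_
  rintro ⟨i, j⟩ ⟨k, l⟩
  have : (T j)ᴴ * T l = V * (diagonal (star (d j)) * diagonal (d l)) * Vᴴ := by
    rw [h3, h3]
    simp only [conjTranspose_mul, conjTranspose_conjTranspose, Matrix.mul_assoc]
    rw [← Matrix.mul_assoc Vᴴ V, h1, Matrix.one_mul, diagonal_conjTranspose]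
  rw [hρ, this, diagonal_mul_diagonal, mul_apply]
  refine Finset.sum_congr rfl fun t _ => ?_
  simp [mul_diagonal]; ring

/-- Gram factorisation with prescribed number of rows -/
lemma gram {n : Type} [Fintype n] [DecidableEq n] {ρ : Matrix n n ℂ} (h : ρ.PosSemidef) {r : ℕ}
    (hr : ρ.rank ≤ r) : ∃ F : Matrix (Fin r) n ℂ, ρ = Fᴴ * F := by
  let D := {i // h.1.eigenvalues i ≠ 0}
  have hc : Fintype.card D ≤ Fintype.card (Fin r) := by
    rw [← h.1.rank_eq_card_non_zero_eigs]; simpa using hr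
  obtain ⟨g⟩ := Function.Embedding.nonempty_of_card_le hc
  let U : Matrix n n ℂ := h.1.eigenvectorUnitary
  let J : Matrix (Fin r) D ℂ := of fun x t => if g t = x then 1 else 0
  let B : Matrix D n ℂ := of fun t i => (Real.sqrt (h.1.eigenvalues t) : ℂ) * star (U i t)
  have hJ : Jᴴ * J = 1 := by
    ext s t
    simp only [J, mul_apply, conjTranspose_apply, of_apply, one_apply]
    by_cases hst : s = t
    · subst hst; simp
    · simp [hst, g.injective.ne hst]
  have hB : Bᴴ * B = ρ := by
    conv_rhs => rw [h.1.spectral_theorem, Unitary.conjStarAlgAut_apply]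
    ext i k
    rw [mul_apply, mul_apply]
    have e : ∀ t : n, (((h.1.eigenvectorUnitary : Matrix n n ℂ) *
        diagonal (RCLike.ofReal ∘ h.1.eigenvalues) : Matrix n n ℂ)) i t *
        (star (h.1.eigenvectorUnitary : Matrix n n ℂ)) t k =
        (h.1.eigenvalues t : ℂ) * (U i t * star (U k t)) := by
      intro t
      simp [mul_diagonal, U]; ring
    have e2 : ∀ t : D, Bᴴ i t * B t k = (h.1.eigenvalues t : ℂ) * (U i t * star (U k t)) := by
      intro t
      have := Real.mul_self_sqrt (h.eigenvalues_nonneg t)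
      simp only [B, conjTranspose_apply, of_apply, star_mul', star_star]
      rw [← this]
      simp; ring
    simp_rw [e2]
    refine Eq.trans ?_ (Finset.sum_congr rfl fun t _ => (e t).symm)
    have key := Finset.sum_subtype (F := inferInstanceAs (Fintype D)) (Finset.univ.filter fun t => h.1.eigenvalues t ≠ 0)
      (p := fun t => h.1.eigenvalues t ≠ 0) (by simp)
      (fun t => (h.1.eigenvalues t : ℂ) * (U i t * star (U k t)))
    refine key.symm.trans ?_
    rw [Finset.sum_filter_of_ne]
    intro x _ hx h0
    simp [h0] at hx
  refine ⟨J * B, ?_⟩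
  rw [conjTranspose_mul, Matrix.mul_assoc, ← Matrix.mul_assoc Jᴴ, hJ, Matrix.one_mul, hB]


lemma outer_eq {d : Type} (v : d → ℂ) : outer v = vecMulVec v (star v) := by
  ext; simp [outer, vecMulVec]

lemma lemK_facts {n : Type} [Fintype n] [DecidableEq n] (N : Matrix n n ℂ) (m ν : n → ℂ)
    (h : N * Nᴴ + outer m = Nᴴ * N + outer ν) :
    star m ⬝ᵥ m = star ν ⬝ᵥ ν ∧ star m ⬝ᵥ (N *ᵥ m) = star ν ⬝ᵥ (N *ᵥ ν) ∧
    star (Nᴴ *ᵥ m) ⬝ᵥ (Nᴴ *ᵥ m) = star (N *ᵥ ν) ⬝ᵥ (N *ᵥ ν) := by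
  rw [outer_eq, outer_eq] at h
  have h1 : star m ⬝ᵥ m = star ν ⬝ᵥ ν := by
    have := congrArg trace h
    rw [trace_add, trace_add, trace_mul_comm, trace_vecMulVec, trace_vecMulVec] at this
    rw [dotProduct_comm, dotProduct_comm (star ν)]
    exact add_left_cancel this
  have h2 : star m ⬝ᵥ (N *ᵥ m) = star ν ⬝ᵥ (N *ᵥ ν) := by
    have := congrArg (fun X => trace (N * X)) h
    simp only [Matrix.mul_add, trace_add, mul_vecMulVec, trace_vecMulVec] at this
    rw [← Matrix.mul_assoc, trace_mul_comm (N * N), ← Matrix.mul_assoc,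
      trace_mul_comm (Nᴴ * N)] at this
    rw [← Matrix.mul_assoc] at this
    rw [dotProduct_comm, dotProduct_comm (star ν)]
    rw [Matrix.mul_assoc] at this
    exact add_left_cancel this
  refine ⟨h1, h2, ?_⟩
  have h3 := congrArg (fun X => trace (X * X)) h
  simp only [Matrix.mul_add, Matrix.add_mul, trace_add, mul_vecMulVec, vecMulVec_mul,
    trace_vecMulVec, add_mulVec, add_dotProduct, vecMulVec_mulVec] at h3
  have e1 : trace (N * Nᴴ * (N * Nᴴ)) = trace (Nᴴ * N * (Nᴴ * N)) := by
    rw [Matrix.mul_assoc, trace_mul_comm]; simp only [Matrix.mul_assoc]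
  have e2 : ∀ (M : Matrix n n ℂ) (v : n → ℂ), ((M * Mᴴ) *ᵥ v) ⬝ᵥ star v =
      star (Mᴴ *ᵥ v) ⬝ᵥ (Mᴴ *ᵥ v) := by
    intro M v
    rw [star_mulVec, conjTranspose_conjTranspose, ← dotProduct_mulVec, mulVec_mulVec,
      dotProduct_comm]
  have e3 : ∀ (M : Matrix n n ℂ) (v : n → ℂ), v ⬝ᵥ (star v ᵥ* (M * Mᴴ)) =
      star (Mᴴ *ᵥ v) ⬝ᵥ (Mᴴ *ᵥ v) := by
    intro M v
    rw [star_mulVec, conjTranspose_conjTranspose, ← dotProduct_mulVec, mulVec_mulVec,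
      dotProduct_comm, ← dotProduct_mulVec]
  have e4 := e2 Nᴴ ν
  have e5 := e3 Nᴴ ν
  rw [conjTranspose_conjTranspose] at e4 e5
  rw [e1, e2, e3, e4, e5] at h3
  have h4 : (m ⬝ᵥ star m) = ν ⬝ᵥ star ν := by
    rw [dotProduct_comm, h1, dotProduct_comm]
  simp only [smul_dotProduct, h1, h4] at h3
  linear_combination h3 / 2

lemma lemK (N : Matrix (Fin 3) (Fin 3) ℂ) (m ν : Fin 3 → ℂ)
    (h : N * Nᴴ + outer m = Nᴴ * N + outer ν) :
    outer m = outer ν ∨ ∃ (m1 : Fin 3 → ℂ) (p : ℂ), outer m1 = outer m ∧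
      star m1 ⬝ᵥ m1 = star ν ⬝ᵥ ν ∧ Nᴴ *ᵥ m1 + p • ν = N *ᵥ ν + star p • m1 := by
  obtain ⟨h1, h2, h3⟩ := lemK_facts N m ν h
  by_cases hli : ∃ a b : ℂ, (a ≠ 0 ∨ b ≠ 0) ∧ a • ν + b • m = 0
  · left
    obtain ⟨a, b, hab, h0⟩ := hli
    have n0 : ∀ v : Fin 3 → ℂ, star v ⬝ᵥ v = 0 → v = 0 := fun v hv => by
      exact dotProduct_star_self_eq_zero.1 hv
    by_cases hν : ν = 0
    · subst hν
      have : m = 0 := n0 m (by simpa using h1)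
      rw [this]
    by_cases hb : b = 0
    · subst hb
      have ha : a ≠ 0 := by simpa using hab
      exact absurd (by simpa [ha] using h0) hν
    have hm : m = (-a / b) • ν := by
      ext i
      have := congrFun h0 i
      simp at this ⊢
      field_simp
      linear_combination this
    set c := -a / b
    rw [hm] at h1
    have hk : star ν ⬝ᵥ ν ≠ 0 := fun hh => hν (n0 _ hh)
    have hc : star c * c = 1 := by
      simp only [star_smul, smul_dotProduct, dotProduct_smul, smul_eq_mul] at h1
      have : (star c * c - 1) * (star ν ⬝ᵥ ν) = 0 := by linear_combination h1
      rcases mul_eq_zero.1 this with h | h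
      · linear_combination h
      · exact absurd h hk
    ext i j
    rw [hm]
    simp only [outer, of_apply, Pi.smul_apply, smul_eq_mul, star_mul']
    linear_combination (ν i * star (ν j)) * hc
  · right
    have hli' : ∀ a b : ℂ, a • ν + b • m = 0 → a = 0 ∧ b = 0 := by
      intro a b hab
      by_contra hh
      exact hli ⟨a, b, by tauto, hab⟩
    set u := Nᴴ *ᵥ m with hu
    set u' := N *ᵥ ν with hu'
    let D : Matrix (Fin 3) (Fin 3) ℂ := of ![ν, m, u]
    let D' : Matrix (Fin 3) (Fin 3) ℂ := of ![m, ν, u']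
    let E : Matrix (Fin 3) (Fin 3) ℂ := of ![ν, m, u']
    have hs : ∀ v w : Fin 3 → ℂ, star (star v ⬝ᵥ w) = star w ⬝ᵥ v := fun v w => by
      rw [star_dotProduct, star_star]
    have hd : ∀ v w : Fin 3 → ℂ, v ⬝ᵥ star w = star w ⬝ᵥ v := fun v w => dotProduct_comm _ _
    have hN : ∀ v w : Fin 3 → ℂ, star v ⬝ᵥ (Nᴴ *ᵥ w) = star (N *ᵥ v) ⬝ᵥ w := fun v w => by
      rw [star_mulVec, dotProduct_mulVec]
    have g : D' * D'ᴴ = (D * Dᴴ)ᵀ := by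
      have gen : ∀ (r s : Fin 3 → Fin 3 → ℂ) (i j), ((of r : Matrix _ _ ℂ) * (of s)ᴴ) i j = star (s j) ⬝ᵥ r i := by
        intro r s i j
        rw [dotProduct_comm]
        rfl
      ext i j
      rw [transpose_apply, gen, gen]
      have a1 : star u' ⬝ᵥ m = star ν ⬝ᵥ u := (hN ν m).symm
      have a2 : star m ⬝ᵥ u' = star u ⬝ᵥ ν := by rw [← hs, a1, hs]
      have a3 : star ν ⬝ᵥ u' = star u ⬝ᵥ m := by
        rw [← h2, ← hs m u, hu, hN, hs]
      have a4 : star u' ⬝ᵥ ν = star m ⬝ᵥ u := by rw [← hs, a3, hs]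
      fin_cases i <;> fin_cases j <;> simp [a1, a2, a3, a4, h1, h3]
    have hdet : ‖E.det‖ = ‖D.det‖ := by
      have e := congrArg det g
      rw [det_transpose, det_mul, det_mul, det_conjTranspose, det_conjTranspose] at e
      have hE : D'.det = - E.det := by
        simp [D', E, det_fin_three]; ring
      rw [hE] at e
      have : ‖E.det‖ ^ 2 = ‖D.det‖ ^ 2 := by
        have := congrArg norm e
        simpa [sq] using this
      exact (pow_left_inj₀ (norm_nonneg _) (norm_nonneg _) two_ne_zero).1 this
    obtain ⟨θ, hθ, hθ2⟩ : ∃ θ : ℂ, star θ * θ = 1 ∧ E.det = θ * D.det := by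
      by_cases hD : D.det = 0
      · refine ⟨1, by simp, ?_⟩
        rw [hD] at hdet ⊢
        simpa using hdet
      · refine ⟨E.det / D.det, ?_, by field_simp⟩
        rw [mul_comm, Complex.star_def, Complex.mul_conj, Complex.normSq_eq_norm_sq, norm_div, hdet, div_self (by simpa using hD)]
        simp
    have hz : det (of ![ν, m, u' - θ • u] : Matrix (Fin 3) (Fin 3) ℂ) = 0 := by
      have : det (of ![ν, m, u' - θ • u] : Matrix (Fin 3) (Fin 3) ℂ) = E.det - θ * D.det := by
        simp [D, E, det_fin_three]; ring
      rw [this, hθ2, sub_self]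
    obtain ⟨w, hw0, hw⟩ := exists_vecMul_eq_zero_iff.2 hz
    have hw' : ∀ i, w 0 * ν i + w 1 * m i + w 2 * (u' i - θ * u i) = 0 := by
      intro i
      have := congrFun hw i
      simpa [vecMul, dotProduct, Fin.sum_univ_three] using this
    have hw2 : w 2 ≠ 0 := by
      intro h0
      have := hli' (w 0) (w 1) (by
        ext i; have := hw' i; rw [h0] at this; simpa using this)
      apply hw0
      ext i; fin_cases i <;> simp [this, h0]
    have hθ0 : θ ≠ 0 := by rintro rfl; simp at hθ
    set m1 := θ • m with hm1
    obtain ⟨p, q, hpq⟩ : ∃ p q : ℂ, u' - Nᴴ *ᵥ m1 = p • ν - q • m1 := by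
      refine ⟨- w 0 / w 2, w 1 / w 2 / θ, ?_⟩
      ext i
      have := hw' i
      rw [hm1, mulVec_smul, ← hu]
      simp only [Pi.sub_apply, Pi.smul_apply, smul_eq_mul]
      field_simp
      linear_combination this
    have k1 : star m1 ⬝ᵥ m1 = star ν ⬝ᵥ ν := by
      rw [hm1, star_smul, smul_dotProduct, dotProduct_smul, ← h1, smul_smul, hθ, one_smul]
    have k2 : star m1 ⬝ᵥ (N *ᵥ m1) = star ν ⬝ᵥ (N *ᵥ ν) := by
      rw [hm1, star_smul, mulVec_smul, smul_dotProduct, dotProduct_smul, ← h2, smul_smul, hθ,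
        one_smul]
    have i1 := congrArg (fun v => star ν ⬝ᵥ v) hpq
    have i2 := congrArg (fun v => star (star m1 ⬝ᵥ v)) hpq
    simp only [dotProduct_sub, dotProduct_smul, star_sub, star_mul', smul_eq_mul, hs] at i1 i2
    have i3 : star (Nᴴ *ᵥ m1) ⬝ᵥ m1 = star m1 ⬝ᵥ (N *ᵥ m1) := by
      rw [← hs, hN, hs]
    have i4 : star u' ⬝ᵥ m1 = star ν ⬝ᵥ (Nᴴ *ᵥ m1) := (hN _ _).symm
    rw [i3, i4, k2, ← hu', k1] at i2
    set k := star ν ⬝ᵥ ν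
    set c := star ν ⬝ᵥ m1
    have kr : star k = k := hs _ _
    have rel : k * (p - star q) + c * star (p - star q) = 0 := by
      simp only [star_sub, star_star]
      linear_combination - i1 - i2
    have hw3 : star (p - star q) • m1 + (p - star q) • ν = 0 := by
      apply dotProduct_star_self_eq_zero.1
      have hc1 : star m1 ⬝ᵥ ν = star c := (hs _ _).symm
      have rel2 := congrArg star rel
      simp only [star_add, star_mul', star_star, star_zero, kr] at rel2
      simp only [star_add, star_smul, add_dotProduct, dotProduct_add, smul_dotProduct,
        dotProduct_smul, smul_eq_mul, star_star, k1, hc1]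
      change star (p - star q) * ((p - star q) * k + star (p - star q) * c) + (p - star q) * ((p - star q) * star c + star (p - star q) * k) = 0
      linear_combination star (p - star q) * rel + (p - star q) * rel2
    have hδ : p = star q := by
      rw [hm1, smul_smul, add_comm] at hw3
      exact sub_eq_zero.1 (hli' _ _ hw3).1
    refine ⟨m1, p, ?_, k1, ?_⟩
    · ext i j
      simp only [outer, hm1, of_apply, Pi.smul_apply, smul_eq_mul, star_mul']
      linear_combination (m i * star (m j)) * hθ
    · have : star p = q := by rw [hδ, star_star]
      rw [this]
      ext i
      have := congrFun hpq i
      simp at this ⊢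
      linear_combination - this


def blk {α β : Type} (ρ : Matrix (α × β) (α × β) ℂ) (j l : β) : Matrix α α ℂ :=
  of fun i k => ρ (i, j) (k, l)

lemma blk_ltr {α β α' : Type} [Fintype α] [Fintype β] [DecidableEq β] 
    (S : Matrix α α' ℂ) (ρ : Matrix (α × β) (α × β) ℂ) (j l : β) :
    blk (ltr S 1 ρ) j l = Sᴴ * blk ρ j l * S := by
  ext i k
  simp [blk, ltr, mul_apply, Fintype.sum_prod_type, one_apply, apply_ite (starRingEnd ℂ)]

lemma norm_one {a : ℕ} {K : Matrix (Fin a) (Fin a) ℂ} (hK : K.PosDef) :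
    ∃ S : Matrix (Fin a) (Fin a) ℂ, IsUnit S ∧ Sᴴ * K * S = 1 := by
  obtain ⟨B, hB⟩ := gram hK.posSemidef (r := a) (by simpa using K.rank_le_card_width)
  have hBu : IsUnit B := by
    have := hK.isUnit
    rw [hB, isUnit_iff_isUnit_det, det_mul] at this
    exact (isUnit_iff_isUnit_det _).2 (isUnit_of_mul_isUnit_right this)
  have hBd := (isUnit_iff_isUnit_det _).1 hBu
  refine ⟨B⁻¹, isUnit_nonsing_inv_iff.2 hBu, ?_⟩
  rw [hB, conjTranspose_nonsing_inv]
  have h1 : B * B⁻¹ = 1 := mul_nonsing_inv _ hBd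
  have h2 : Bᴴ⁻¹ * Bᴴ = 1 := nonsing_inv_mul _ (by rw [det_conjTranspose]; exact hBd.star)
  rw [← Matrix.mul_assoc, h2, Matrix.one_mul, h1]

lemma schur_psd {α : Type} [Fintype α] [DecidableEq α]
    {ρ : Matrix (α × Fin 2) (α × Fin 2) ℂ} (h : ρ.PosSemidef) (h1 : blk ρ 0 0 = 1) :
    (blk ρ 1 1 - (blk ρ 0 1)ᴴ * blk ρ 0 1).PosSemidef := by
  obtain ⟨F, hF⟩ := gram h le_rfl
  let G : Fin 2 → Matrix (Fin ρ.rank) α ℂ := fun j => of fun x i => F x (i, j)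
  have hb : ∀ j l, blk ρ j l = (G j)ᴴ * G l := by
    intro j l
    ext i k
    conv_lhs => rw [blk, of_apply, hF]
    rfl
  rw [hb] at h1
  have e : blk ρ 1 1 - (blk ρ 0 1)ᴴ * blk ρ 0 1 =
      (G 1 - G 0 * ((G 0)ᴴ * G 1))ᴴ * (G 1 - G 0 * ((G 0)ᴴ * G 1)) := by
    rw [hb, hb]
    simp only [conjTranspose_sub, conjTranspose_mul, conjTranspose_conjTranspose, Matrix.mul_sub,
      Matrix.sub_mul]
    have : (G 1)ᴴ * G 0 * (G 0)ᴴ * (G 0 * ((G 0)ᴴ * G 1)) = (G 1)ᴴ * G 0 * ((G 0)ᴴ * G 1) := by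
      rw [Matrix.mul_assoc ((G 1)ᴴ * G 0), ← Matrix.mul_assoc (G 0)ᴴ (G 0), h1, Matrix.one_mul]
    rw [this]
    simp only [Matrix.mul_assoc]
    abel
  rw [e]
  exact posSemidef_conjTranspose_mul_self _

lemma schur_eq {ρ : Matrix (Fin 3 × Fin 2) (Fin 3 × Fin 2) ℂ} (h : ρ.PosSemidef)
    (hr : ρ.rank ≤ 3) (h1 : blk ρ 0 0 = 1) :
    blk ρ 1 1 = (blk ρ 0 1)ᴴ * blk ρ 0 1 := by
  obtain ⟨F, hF⟩ := gram h hr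
  let G : Fin 2 → Matrix (Fin 3) (Fin 3) ℂ := fun j => of fun x i => F x (i, j)
  have hb : ∀ j l, blk ρ j l = (G j)ᴴ * G l := by
    intro j l
    ext i k
    conv_lhs => rw [blk, of_apply, hF]
    rfl
  rw [hb] at h1
  rw [hb, hb, conjTranspose_mul, conjTranspose_conjTranspose, Matrix.mul_assoc,
    ← Matrix.mul_assoc (G 0), mul_eq_one_comm.1 h1, Matrix.one_mul]

lemma exists_unit_ker {a b : ℕ} (A : Matrix (Fin a) (Fin b) ℂ) (hab : a < b) :
    ∃ v : Fin b → ℂ, A *ᵥ v = 0 ∧ star v ⬝ᵥ v = 1 := by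
  have := LinearMap.ker_ne_bot_of_finrank_lt (f := A.mulVecLin) (by simpa using hab)
  obtain ⟨v, hv, hv0⟩ := Submodule.exists_mem_ne_zero_of_ne_bot this
  have hv1 : A *ᵥ v = 0 := by simpa using hv
  have hpos : 0 < star v ⬝ᵥ v := dotProduct_star_self_pos_iff.2 hv0
  obtain ⟨r, hr0, hr⟩ : ∃ r : ℝ, 0 < r ∧ star v ⬝ᵥ v = r := by
    rw [Complex.pos_iff] at hpos
    refine ⟨(star v ⬝ᵥ v).re, hpos.1, ?_⟩
    apply Complex.ext <;> simp [← hpos.2]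
  refine ⟨((Real.sqrt r)⁻¹ : ℂ) • v, by rw [mulVec_smul, hv1, smul_zero], ?_⟩
  rw [star_smul, smul_dotProduct, dotProduct_smul, hr, smul_smul]
  have : (Real.sqrt r : ℂ) * Real.sqrt r = r := by
    rw [← Complex.ofReal_mul, Real.mul_self_sqrt hr0.le]
  have h0 : (Real.sqrt r : ℂ) ≠ 0 := by
    simpa using (Real.sqrt_pos.2 hr0).ne'
  simp only [star_inv₀, Complex.star_def, Complex.conj_ofReal, smul_eq_mul]
  rw [← this]; field_simp

lemma complete_col {F0 : Matrix (Fin 4) (Fin 3) ℂ} (h : F0ᴴ * F0 = 1) :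
    ∃ q : Fin 4 → ℂ, F0 * F0ᴴ + outer q = 1 := by
  obtain ⟨q, hq, hq1⟩ := exists_unit_ker F0ᴴ (by norm_num)
  refine ⟨q, ?_⟩
  let Q : Matrix (Fin 4) Unit ℂ := replicateCol Unit q
  have e1 : (F0.fromCols Q)ᴴ * F0.fromCols Q = 1 := by
    rw [conjTranspose_fromCols_eq_fromRows_conjTranspose, fromRows_mul_fromCols, h,
      ← fromBlocks_one]
    have a1 : F0ᴴ * Q = 0 := by
      ext i j
      exact congrFun hq i
    have a2 : Qᴴ * F0 = 0 := by
      have := congrArg conjTranspose a1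
      simpa using this
    have a3 : Qᴴ * Q = 1 := by
      ext i j
      simpa [mul_apply, Q, dotProduct] using hq1
    rw [a1, a2, a3]
  have e2 := (mul_eq_one_comm_of_card_eq _ _ ℂ (by simp)).1 e1
  rw [conjTranspose_fromCols_eq_fromRows_conjTranspose, fromCols_mul_fromRows] at e2
  rw [← e2]
  congr 1
  ext i j
  simp [mul_apply, Q, outer]

lemma schur_vec {ρ : Matrix (Fin 3 × Fin 2) (Fin 3 × Fin 2) ℂ} (h : ρ.PosSemidef)
    (hr : ρ.rank ≤ 4) (h1 : blk ρ 0 0 = 1) :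
    ∃ ν : Fin 3 → ℂ, blk ρ 1 1 = (blk ρ 0 1)ᴴ * blk ρ 0 1 + outer ν := by
  obtain ⟨F, hF⟩ := gram h hr
  let G : Fin 2 → Matrix (Fin 4) (Fin 3) ℂ := fun j => of fun x i => F x (i, j)
  have hb : ∀ j l, blk ρ j l = (G j)ᴴ * G l := by
    intro j l
    ext i k
    conv_lhs => rw [blk, of_apply, hF]
    rfl
  rw [hb] at h1
  obtain ⟨q, hq⟩ := complete_col h1
  refine ⟨(G 1)ᴴ *ᵥ q, ?_⟩
  rw [← outer_mul, hb, hb]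
  conv_lhs => rw [← Matrix.mul_one (G 1)ᴴ, ← hq]
  simp only [conjTranspose_mul, conjTranspose_conjTranspose, Matrix.mul_add, Matrix.add_mul,
    Matrix.mul_assoc]

lemma herm_blk {α β : Type} {ρ : Matrix (α × β) (α × β) ℂ} (h : ρ.IsHermitian) (j l : β) :
    (blk ρ j l)ᴴ = blk ρ l j := by
  ext i k
  exact h.apply _ _

lemma blk_pt {α β : Type} (ρ : Matrix (α × β) (α × β) ℂ) (j l : β) :
    blk (pt ρ) j l = blk ρ l j := rfl

lemma sep_of_blk {α n : Type} [Fintype α] [Fintype n] [DecidableEq n] [DecidableEq α]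
    {ρ : Matrix (α × Fin 2) (α × Fin 2) ℂ} (hρ : ρ.IsHermitian) (e : α → n)
    (he : Function.Injective e)
    (M : Matrix n n ℂ) (hM : Mᴴ * M = M * Mᴴ) (h00 : blk ρ 0 0 = 1)
    (h01 : blk ρ 0 1 = M.submatrix e e) (h11 : blk ρ 1 1 = (Mᴴ * M).submatrix e e) : Sepa ρ := by
  refine sep_normal (fun j : Fin 2 => if j = 0 then (1 : Matrix n n ℂ) else M) ?_ e ?_
  · intro i j
    fin_cases i <;> fin_cases j <;> simp [hM]
  · intro i j k l
    have h10 : blk ρ 1 0 = (Mᴴ).submatrix e e := by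
      rw [← herm_blk hρ, h01]; rfl
    fin_cases j <;> fin_cases l
    · have := congrFun (congrFun h00 i) k
      simp only [blk, of_apply] at this
      simp [this, one_apply, he.eq_iff]
    · have := congrFun (congrFun h01 i) k
      simpa [blk] using this
    · have := congrFun (congrFun h10 i) k
      simpa [blk] using this
    · have := congrFun (congrFun h11 i) k
      simpa [blk] using this

lemma comp3_one {ρ : Matrix (Fin 3 × Fin 2) (Fin 3 × Fin 2) ℂ} (h : PPT ρ)
    (hr : ρ.rank ≤ 4) (hs : (pt ρ).rank ≤ 4) (h1 : blk ρ 0 0 = 1) : Sepa ρ := by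
  obtain ⟨ν, hν⟩ := schur_vec h.1 hr h1
  obtain ⟨m, hm⟩ := schur_vec h.2 hs (by rw [blk_pt]; exact h1)
  rw [blk_pt, blk_pt, ← herm_blk h.1.1 0 1, conjTranspose_conjTranspose] at hm
  set N := blk ρ 0 1 with hN
  rcases lemK N m ν (by rw [← hm, hν]) with hK | ⟨m1, p, hm1, hk, hp⟩
  · have hnorm : Nᴴ * N = N * Nᴴ := by
      rw [hm, hK] at hν
      exact (add_right_cancel hν).symm
    let τ : Matrix (Fin 3 × Fin 2) (Fin 3 × Fin 2) ℂ := outer (pv ν ![0, 1])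
    have hs : Sepa (ρ - τ) := by
      refine sep_of_blk ?_ id Function.injective_id N hnorm ?_ ?_ ?_
      · exact h.1.1.sub (outer_psd _).1
      · rw [← h1]; ext i k; simp [blk, τ, outer, pv]
      · rw [hN]; ext i k; simp [blk, τ, outer, pv]
      · ext i k
        have := congrFun (congrFun hν i) k
        simp only [blk, of_apply, Matrix.add_apply] at this
        simp [blk, τ, outer, pv, this]
    have := hs.add (sep_outer ν ![0, 1])
    simpa [τ] using this
  · let M : Matrix (Fin 3 ⊕ Unit) (Fin 3 ⊕ Unit) ℂ :=
      fromBlocks N (replicateCol Unit m1) (replicateCol Unit ν)ᴴ (of fun _ _ => p)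
    have hMM : Mᴴ * M = fromBlocks (Nᴴ * N + outer ν) (replicateCol Unit (Nᴴ *ᵥ m1 + p • ν))
        (replicateCol Unit (Nᴴ *ᵥ m1 + p • ν))ᴴ (of fun _ _ => star m1 ⬝ᵥ m1 + star p * p) := by
      rw [fromBlocks_conjTranspose, fromBlocks_multiply]
      congr 1
      · congr 1; ext i j; simp [mul_apply, outer]
      · ext i j; simp [mul_apply, mulVec, dotProduct, mul_comm]
      · ext i j
        simp [mul_apply, mulVec, dotProduct, mul_comm]
      · ext i j; simp [mul_apply, dotProduct]
    have hMM' : M * Mᴴ = fromBlocks (N * Nᴴ + outer m1) (replicateCol Unit (N *ᵥ ν + star p • m1))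
        (replicateCol Unit (N *ᵥ ν + star p • m1))ᴴ
        (of fun _ _ => star ν ⬝ᵥ ν + star p * p) := by
      rw [fromBlocks_conjTranspose, fromBlocks_multiply]
      congr 1
      · congr 1; ext i j; simp [mul_apply, outer]
      · ext i j; simp [mul_apply, mulVec, dotProduct, mul_comm]
      · ext i j
        simp [mul_apply, mulVec, dotProduct, mul_comm]
      · ext i j; simp [mul_apply, dotProduct, mul_comm]
    refine sep_of_blk h.1.1 Sum.inl Sum.inl_injective M ?_ h1 ?_ ?_
    · rw [hMM, hMM', hp, hk, hm1, ← hm, hν]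
    · rw [← hN]; rfl
    · rw [hMM, hν]; rfl

lemma comp3 {ρ : Matrix (Fin 3 × Fin 2) (Fin 3 × Fin 2) ℂ} (h : PPT ρ)
    (hr : ρ.rank ≤ 4) (hs : (pt ρ).rank ≤ 4) (h1 : (blk ρ 0 0).PosDef) : Sepa ρ := by
  obtain ⟨S, hS, hS1⟩ := norm_one h1
  apply sep_of_ltr hS isUnit_one
  refine comp3_one (h.ltr _ _) ((rank_ltr_le _ _ _).trans hr) ?_ (by rw [blk_ltr, hS1])
  rw [pt_ltr]; exact (rank_ltr_le _ _ _).trans hs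

lemma compNormal {ρ : Matrix (Fin 3 × Fin 2) (Fin 3 × Fin 2) ℂ} (h : PPT ρ)
    (hr : ρ.rank ≤ 3) (h1 : (blk ρ 0 0).PosDef) : Sepa ρ := by
  obtain ⟨S, hS, hS1⟩ := norm_one h1
  apply sep_of_ltr hS isUnit_one
  have hr' : (ltr S (1 : Matrix (Fin 2) (Fin 2) ℂ) ρ).rank ≤ 3 := (rank_ltr_le _ _ _).trans hr
  have h' := h.ltr S (1 : Matrix (Fin 2) (Fin 2) ℂ)
  have h1' : blk (ltr S (1 : Matrix (Fin 2) (Fin 2) ℂ) ρ) 0 0 = 1 := by rw [blk_ltr, hS1]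
  generalize ltr S (1 : Matrix (Fin 2) (Fin 2) ℂ) ρ = τ at *
  have e1 := schur_eq h'.1 hr' h1'
  have e2 := schur_psd h'.2 (by rw [blk_pt]; exact h1')
  rw [blk_pt, blk_pt, ← herm_blk h'.1.1 0 1, conjTranspose_conjTranspose, e1] at e2
  have e3 : (blk τ 0 1)ᴴ * blk τ 0 1 - blk τ 0 1 * (blk τ 0 1)ᴴ = 0 := by
    rw [← e2.trace_eq_zero_iff, trace_sub, trace_mul_comm, sub_self]
  exact sep_of_blk h'.1.1 id Function.injective_id (blk τ 0 1) (sub_eq_zero.1 e3) h1' rfl e1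


section
variable {n : Type} [Fintype n] [DecidableEq n]

lemma psd_ker {M : Matrix n n ℂ} (h : M.PosSemidef) {x : n → ℂ} (hx : star x ⬝ᵥ (M *ᵥ x) = 0) :
    M *ᵥ x = 0 := (h.dotProduct_mulVec_zero_iff x).1 hx

lemma posDef_of {M : Matrix n n ℂ} (h : M.PosSemidef) (h0 : ∀ x, M *ᵥ x = 0 → x = 0) :
    M.PosDef := by
  refine PosDef.of_dotProduct_mulVec_pos h.1 fun x hx => ?_
  refine lt_of_le_of_ne (h.dotProduct_mulVec_nonneg x) fun h1 => hx (h0 x (psd_ker h h1.symm))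

lemma psd_diag_zero {M : Matrix n n ℂ} (h : M.PosSemidef) {p : n} (hp : M p p = 0) (q : n) :
    M q p = 0 ∧ M p q = 0 := by
  have h1 : M *ᵥ (Pi.single p 1) = 0 := psd_ker h (by simp [hp])
  have h2 : M q p = 0 := by simpa using congrFun h1 q
  refine ⟨h2, ?_⟩
  rw [← h.1.apply, h2, star_zero]

lemma rank_le_of_ker {A B : Matrix n n ℂ} (h : ∀ z, A *ᵥ z = 0 → B *ᵥ z = 0) :
    B.rank ≤ A.rank ∧ (B.rank = A.rank → ∀ z, B *ᵥ z = 0 → A *ᵥ z = 0) := by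
  have h1 := LinearMap.finrank_range_add_finrank_ker A.mulVecLin
  have h2 := LinearMap.finrank_range_add_finrank_ker B.mulVecLin
  have hle : LinearMap.ker A.mulVecLin ≤ LinearMap.ker B.mulVecLin := fun z hz => by
    simpa using h z (by simpa using hz)
  have h3 := Submodule.finrank_mono hle
  rw [← Matrix.rank] at h1 h2
  refine ⟨by omega, fun he z hz => ?_⟩
  have := Submodule.eq_of_le_of_finrank_eq hle (by omega)
  have hz' : z ∈ LinearMap.ker B.mulVecLin := by simpa using hz
  rw [← this] at hz'
  simpa using hz'

lemma gram_surj {ρ : Matrix n n ℂ} (h : ρ.PosSemidef) {r : ℕ} (hr : ρ.rank = r) :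
    ∃ (F : Matrix (Fin r) n ℂ) (G : Matrix n (Fin r) ℂ), ρ = Fᴴ * F ∧ F * G = 1 := by
  obtain ⟨F, hF⟩ := gram h hr.le
  have hFr : F.rank = r := by
    have := rank_conjTranspose_mul_self F
    rw [← hF] at this
    exact this.symm.trans hr
  have hs : Function.Surjective F.mulVec := by
    have : LinearMap.range F.mulVecLin = ⊤ := by
      apply Submodule.eq_top_of_finrank_eq
      rw [← Matrix.rank, hFr]; simp
    exact LinearMap.range_eq_top.1 this
  obtain ⟨G, hG⟩ := mulVec_surjective_iff_exists_right_inverse.1 hs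
  exact ⟨F, G, hF, hG⟩

/-- factor through F -/
lemma factor_of_ker {r : ℕ} {m : Type} [Fintype m] [DecidableEq m] {F : Matrix (Fin r) n ℂ} {G : Matrix n (Fin r) ℂ} (hG : F * G = 1)
    {χ : Matrix n m ℂ} (h : ∀ z, (Fᴴ * F) *ᵥ z = 0 → star z ᵥ* χ = 0) : χ = Fᴴ * (Gᴴ * χ) := by
  have h1 : ∀ z, F *ᵥ z = 0 → star z ᵥ* χ = 0 := fun z hz => h z (by
    rw [← mulVec_mulVec, hz, mulVec_zero])
  have h2 : (1 - G * F)ᴴ * χ = 0 := by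
    ext i j
    have := h1 ((1 - G * F) *ᵥ Pi.single i 1) (by
      rw [mulVec_mulVec, Matrix.mul_sub, ← Matrix.mul_assoc, hG, Matrix.mul_one, Matrix.one_mul, sub_self, zero_mulVec])
    rw [star_mulVec, vecMul_vecMul] at this
    simpa using congrFun this j
  rw [conjTranspose_sub, Matrix.sub_mul, conjTranspose_one, Matrix.one_mul, sub_eq_zero,
    conjTranspose_mul, Matrix.mul_assoc] at h2
  exact h2

lemma one_add_psd {B : Matrix n n ℂ} (hB : B.IsHermitian) :
    ∃ ε : ℝ, 0 < ε ∧ (1 + (ε : ℂ) • B).PosSemidef := by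
  let lam := hB.eigenvalues
  set C := ∑ i, |lam i| with hC
  have hC0 : 0 ≤ C := Finset.sum_nonneg fun i _ => abs_nonneg _
  refine ⟨1 / (1 + C), by positivity, ?_⟩
  let U : Matrix n n ℂ := hB.eigenvectorUnitary
  have hU : U * Uᴴ = 1 := (mem_unitaryGroup_iff).1 hB.eigenvectorUnitary.2
  have e : 1 + (((1 / (1 + C) : ℝ)) : ℂ) • B =
      U * diagonal (fun i => ((1 + 1 / (1 + C) * lam i : ℝ) : ℂ)) * Uᴴ := by
    have hs := hB.spectral_theorem
    rw [Unitary.conjStarAlgAut_apply] at hs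
    have hd : diagonal (fun i => ((1 + 1 / (1 + C) * lam i : ℝ) : ℂ)) = (1 : Matrix n n ℂ) +
        ((1 / (1 + C) : ℝ) : ℂ) • diagonal (RCLike.ofReal ∘ lam) := by
      ext i j
      by_cases hij : i = j
      · subst hij; simp
      · simp [hij]
    rw [hd, Matrix.mul_add, Matrix.add_mul, Matrix.mul_one, hU, Matrix.mul_smul, Matrix.smul_mul]
    conv_lhs => rw [hs]
    rfl
  rw [e]
  apply PosSemidef.mul_mul_conjTranspose_same
  rw [posSemidef_diagonal_iff]
  intro i
  rw [Complex.zero_le_real]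
  have h1 : |lam i| ≤ C := Finset.single_le_sum (f := fun i => |lam i|) (fun i _ => abs_nonneg _) (Finset.mem_univ i)
  have h2 : -C ≤ lam i := by linarith [neg_abs_le (lam i)]
  have h3 : 1 + 1 / (1 + C) * lam i = (1 + C + lam i) / (1 + C) := by field_simp
  rw [h3]
  apply div_nonneg <;> linarith

lemma eps_psd {σ H : Matrix n n ℂ} (hσ : σ.PosSemidef) (hH : H.IsHermitian)
    (hk : ∀ z, σ *ᵥ z = 0 → H *ᵥ z = 0) :
    ∃ ε : ℝ, 0 < ε ∧ ∀ t : ℝ, 0 ≤ t → t ≤ ε → (σ + (t : ℂ) • H).PosSemidef := by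
  obtain ⟨F, G, hF, hG⟩ := gram_surj hσ rfl
  have hB : ∃ B : Matrix (Fin σ.rank) (Fin σ.rank) ℂ, B.IsHermitian ∧ H = Fᴴ * B * F := by
    have h1 : H = Fᴴ * (Gᴴ * H) := factor_of_ker hG (by
      intro z hz
      rw [← hF] at hz
      have := congrArg star (hk z hz)
      rwa [star_mulVec, hH, star_zero] at this)
    have h2 : H = H * G * F := by
      have := congrArg conjTranspose h1
      rw [conjTranspose_mul, conjTranspose_mul, conjTranspose_conjTranspose,
        conjTranspose_conjTranspose, hH] at this
      exact this
    refine ⟨Gᴴ * H * G, ?_, ?_⟩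
    · exact isHermitian_conjTranspose_mul_mul _ hH
    · conv_lhs => rw [h1, h2]
      simp only [Matrix.mul_assoc]
  obtain ⟨B, hB, hHB⟩ := hB
  obtain ⟨ε, hε, hp⟩ := one_add_psd hB
  have hfull : (σ + (ε : ℂ) • H).PosSemidef := by
    have : σ + (ε : ℂ) • H = Fᴴ * (1 + (ε : ℂ) • B) * F := by
      conv_lhs => rw [hF, hHB]
      simp only [Matrix.mul_add, Matrix.add_mul, Matrix.mul_one, Matrix.mul_smul, Matrix.smul_mul]
    rw [this]; exact hp.conjTranspose_mul_mul_same _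
  refine ⟨ε, hε, fun t ht ht' => ?_⟩
  have h3 : σ + (t : ℂ) • H = ((1 - t / ε : ℝ) : ℂ) • σ + ((t / ε : ℝ) : ℂ) • (σ + (ε : ℂ) • H) := by
    have : (ε : ℂ) ≠ 0 := by exact_mod_cast hε.ne'
    ext i j
    simp
    field_simp
    ring
  rw [h3]
  refine (hσ.smul ?_).add (hfull.smul ?_)
  · rw [Complex.zero_le_real, sub_nonneg, div_le_one hε]; exact ht'
  · rw [Complex.zero_le_real]; positivity

lemma psd_closed {A B : Matrix n n ℂ} (hA : A.IsHermitian) (hB : B.IsHermitian) :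
    IsClosed {t : ℝ | (A + (t : ℂ) • B).PosSemidef} := by
  have : {t : ℝ | (A + (t : ℂ) • B).PosSemidef} =
      ⋂ x : n → ℂ, {t : ℝ | 0 ≤ star x ⬝ᵥ (A *ᵥ x) + (t : ℂ) * (star x ⬝ᵥ (B *ᵥ x))} := by
    ext t
    simp only [Set.mem_setOf_eq, Set.mem_iInter]
    have hq : ∀ x : n → ℂ, star x ⬝ᵥ ((A + (t : ℂ) • B) *ᵥ x) =
        star x ⬝ᵥ (A *ᵥ x) + (t : ℂ) * (star x ⬝ᵥ (B *ᵥ x)) := fun x => by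
      rw [add_mulVec, dotProduct_add, smul_mulVec, dotProduct_smul, smul_eq_mul]
    constructor
    · intro h x
      rw [← hq]; exact h.dotProduct_mulVec_nonneg x
    · intro h
      refine PosSemidef.of_dotProduct_mulVec_nonneg ?_ fun x => by rw [hq]; exact h x
      refine hA.add ?_
      rw [IsHermitian, conjTranspose_smul, hB]; simp
  rw [this]
  refine isClosed_iInter fun x => isClosed_le continuous_const ?_
  fun_prop

end

section
variable {α β : Type} [Fintype α] [Fintype β] [DecidableEq α] [DecidableEq β]

lemma trace_pt (ρ : Matrix (α × β) (α × β) ℂ) : (pt ρ).trace = ρ.trace := rfl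

lemma perturb_one {ρ H : Matrix (α × β) (α × β) ℂ} (h : PPT ρ) (hH : H.IsHermitian)
    (hk : ∀ z, ρ *ᵥ z = 0 → H *ᵥ z = 0) (hk' : ∀ z, pt ρ *ᵥ z = 0 → pt H *ᵥ z = 0)
    (htr : H.trace = 0) (hne : H ≠ 0) :
    ∃ t : ℝ, 0 < t ∧ PPT (ρ + (t : ℂ) • H) ∧ (ρ + (t : ℂ) • H).rank ≤ ρ.rank ∧
      (ρ + (t : ℂ) • H).rank + (pt (ρ + (t : ℂ) • H)).rank < ρ.rank + (pt ρ).rank := by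
  let S : Set ℝ := {t | PPT (ρ + (t : ℂ) • H)}
  have hpt : ∀ t : ℝ, pt (ρ + (t : ℂ) • H) = pt ρ + (t : ℂ) • pt H := fun t => by
    rw [pt_add, pt_smul]
  have hScl : IsClosed S := by
    have : S = {t : ℝ | (ρ + (t : ℂ) • H).PosSemidef} ∩ {t : ℝ | (pt ρ + (t : ℂ) • pt H).PosSemidef} := by
      ext t; simp only [S, PPT, Set.mem_setOf_eq, Set.mem_inter_iff, hpt]
    rw [this]
    exact (psd_closed h.1.1 hH).inter (psd_closed h.2.1 (pt_herm hH))
  have hbdd : BddAbove S := by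
    have : ¬ ∀ x, 0 ≤ star x ⬝ᵥ (H *ᵥ x) := fun hh =>
      hne ((PosSemidef.of_dotProduct_mulVec_nonneg hH hh).trace_eq_zero_iff.1 htr)
    push Not at this
    obtain ⟨x, hx⟩ := this
    have him : (star x ⬝ᵥ (H *ᵥ x)).im = 0 := hH.im_star_dotProduct_mulVec_self x
    have hre : (star x ⬝ᵥ (H *ᵥ x)).re < 0 := by
      by_contra hc
      exact hx (Complex.nonneg_iff.2 ⟨not_lt.1 hc, him.symm⟩)
    refine ⟨(star x ⬝ᵥ (ρ *ᵥ x)).re / (-(star x ⬝ᵥ (H *ᵥ x)).re), fun t ht => ?_⟩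
    have := (Complex.nonneg_iff.1 (ht.1.dotProduct_mulVec_nonneg x)).1
    rw [add_mulVec, dotProduct_add, smul_mulVec, dotProduct_smul, smul_eq_mul, Complex.add_re,
      Complex.re_ofReal_mul] at this
    rw [le_div_iff₀ (by linarith)]
    linarith
  obtain ⟨e1, he1, hp1⟩ := eps_psd h.1 hH hk
  obtain ⟨e2, he2, hp2⟩ := eps_psd h.2 (pt_herm hH) hk'
  have hmin : min e1 e2 ∈ S := ⟨hp1 _ (by positivity) (min_le_left _ _), by
    rw [hpt]; exact hp2 _ (by positivity) (min_le_right _ _)⟩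
  have hT : sSup S ∈ S := hScl.csSup_mem ⟨_, hmin⟩ hbdd
  have hTpos : 0 < sSup S := lt_of_lt_of_le (by positivity) (le_csSup hbdd hmin)
  set t := sSup S with ht
  have k1 : ∀ z, ρ *ᵥ z = 0 → (ρ + (t : ℂ) • H) *ᵥ z = 0 := fun z hz => by
    rw [add_mulVec, smul_mulVec, hz, hk z hz]; simp
  have k2 : ∀ z, pt ρ *ᵥ z = 0 → (pt (ρ + (t : ℂ) • H)) *ᵥ z = 0 := fun z hz => by
    rw [hpt, add_mulVec, smul_mulVec, hz, hk' z hz]; simp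
  obtain ⟨r1, r1'⟩ := rank_le_of_ker k1
  obtain ⟨r2, r2'⟩ := rank_le_of_ker k2
  refine ⟨t, hTpos, hT, r1, ?_⟩
  by_contra hcon
  have q1 : (ρ + (t : ℂ) • H).rank = ρ.rank := by omega
  have q2 : (pt (ρ + (t : ℂ) • H)).rank = (pt ρ).rank := by omega
  obtain ⟨e1, he1, hp1⟩ := eps_psd hT.1 hH fun z hz => hk z (r1' q1 z hz)
  obtain ⟨e2, he2, hp2⟩ := eps_psd hT.2 (pt_herm hH) fun z hz => hk' z (r2' q2 z hz)
  have hm0 : 0 < min e1 e2 := by positivity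
  have : t + min e1 e2 ∈ S := by
    have a1 := hp1 _ hm0.le (min_le_left _ _)
    have a2 := hp2 _ hm0.le (min_le_right _ _)
    rw [← pt_smul, ← pt_add] at a2
    have e : ρ + (t : ℂ) • H + ((min e1 e2 : ℝ) : ℂ) • H =
        ρ + ((t + min e1 e2 : ℝ) : ℂ) • H := by
      rw [Complex.ofReal_add, add_smul, add_assoc]
    rw [e] at a1 a2
    exact ⟨a1, a2⟩
  have := le_csSup hbdd this
  linarith

lemma PPT.smul {ρ : Matrix (α × β) (α × β) ℂ} (h : PPT ρ) {c : ℝ} (hc : 0 ≤ c) :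
    PPT ((c : ℂ) • ρ) :=
  ⟨h.1.smul (by simpa using hc), by rw [pt_smul]; exact h.2.smul (by simpa using hc)⟩

lemma perturb {ρ H : Matrix (α × β) (α × β) ℂ} (h : PPT ρ) (hH : H.IsHermitian)
    (hk : ∀ z, ρ *ᵥ z = 0 → H *ᵥ z = 0) (hk' : ∀ z, pt ρ *ᵥ z = 0 → pt H *ᵥ z = 0)
    (hnot : ∀ c : ℂ, H ≠ c • ρ) :
    ∃ ρ1 ρ2, ρ = ρ1 + ρ2 ∧ PPT ρ1 ∧ PPT ρ2 ∧ ρ1.rank ≤ ρ.rank ∧ ρ2.rank ≤ ρ.rank ∧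
      ρ1.rank + (pt ρ1).rank < ρ.rank + (pt ρ).rank ∧
      ρ2.rank + (pt ρ2).rank < ρ.rank + (pt ρ).rank := by
  have hρ0 : ρ.trace ≠ 0 := by
    intro h0
    have h1 := h.1.trace_eq_zero_iff.1 h0
    refine hnot 0 ?_
    ext i j
    have := congrFun (hk (Pi.single j 1) (by rw [h1, zero_mulVec])) i
    simpa using this
  have hre : ∀ {M : Matrix (α × β) (α × β) ℂ}, M.IsHermitian → star M.trace = M.trace := fun hM => by
    rw [← trace_conjTranspose, hM]
  set c := H.trace / ρ.trace with hc
  have hcr : star c = c := by rw [hc, star_div₀, hre hH, hre h.1.1]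
  set K := H - c • ρ with hK
  have hKH : K.IsHermitian := by
    refine hH.sub ?_
    rw [IsHermitian, conjTranspose_smul, h.1.1, hcr]
  have hKk : ∀ z, ρ *ᵥ z = 0 → K *ᵥ z = 0 := fun z hz => by
    rw [hK, sub_mulVec, smul_mulVec, hz, hk z hz]; simp
  have hKk' : ∀ z, pt ρ *ᵥ z = 0 → pt K *ᵥ z = 0 := fun z hz => by
    rw [hK, pt_sub, pt_smul, sub_mulVec, smul_mulVec, hz, hk' z hz]; simp
  have hKt : K.trace = 0 := by
    rw [hK, trace_sub, trace_smul, smul_eq_mul, hc]; field_simp; simp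
  have hKn : K ≠ 0 := fun h0 => hnot c (sub_eq_zero.1 h0)
  have hneg : pt (-K) = - pt K := rfl
  obtain ⟨t, ht, p1, q1, s1⟩ := perturb_one h hKH hKk hKk' hKt hKn
  obtain ⟨s, hs, p2, q2, s2⟩ := perturb_one h hKH.neg
    (fun z hz => by rw [neg_mulVec, hKk z hz, neg_zero])
    (fun z hz => by rw [hneg, neg_mulVec, hKk' z hz, neg_zero]) (by rw [trace_neg, hKt, neg_zero])
    (neg_ne_zero.2 hKn)
  have hr : ∀ {d : ℝ} (_ : 0 < d) (M : Matrix (α × β) (α × β) ℂ), ((d : ℂ) • M).rank = M.rank := by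
    intro d hd M
    have hd' : (d : ℂ) ≠ 0 := by exact_mod_cast hd.ne'
    apply le_antisymm
    · exact (rank_le_of_ker fun z hz => by rw [smul_mulVec, hz, smul_zero]).1
    · exact (rank_le_of_ker fun z hz => by
        rw [smul_mulVec] at hz
        exact (smul_eq_zero.1 hz).resolve_left hd').1
  have d1 : 0 < s / (t + s) := by positivity
  have d2 : 0 < t / (t + s) := by positivity
  refine ⟨((s / (t + s) : ℝ) : ℂ) • (ρ + (t : ℂ) • K), ((t / (t + s) : ℝ) : ℂ) • (ρ + (s : ℂ) • (-K)),
    ?_, p1.smul d1.le, p2.smul d2.le, ?_, ?_, ?_, ?_⟩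
  · have : (t : ℂ) + s ≠ 0 := by exact_mod_cast (by positivity : t + s ≠ 0)
    ext i j
    simp only [Matrix.add_apply, Matrix.smul_apply, smul_eq_mul, Matrix.neg_apply]
    push_cast
    field_simp
    ring
  · rw [hr d1]; exact q1
  · rw [hr d2]; exact q2
  · rw [pt_smul, hr d1, hr d1]; exact s1
  · rw [pt_smul, hr d2, hr d2]; exact s2

end


section
variable {β : Type} [Fintype β] [DecidableEq β]

noncomputable def pR {a : ℕ} (c : Fin (a+1) → ℂ) : Matrix (Fin (a+1)) (Fin a) ℂ :=
  of fun i k => Fin.cases (- c k.succ) (fun i' => if i' = k then 1 else 0) i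

noncomputable def pQ (a : ℕ) : Matrix (Fin a) (Fin (a+1)) ℂ :=
  of fun i k => if k = i.succ then 1 else 0

lemma pQ_conj {a : ℕ} (Y : Matrix (Fin a) (Fin a) ℂ) :
    (∀ k, ((pQ a)ᴴ * Y * pQ a) 0 k = 0) ∧ (∀ k, ((pQ a)ᴴ * Y * pQ a) k 0 = 0) ∧
    ∀ i k : Fin a, ((pQ a)ᴴ * Y * pQ a) i.succ k.succ = Y i k := by
  have h0 : ∀ k : Fin a, ¬ (0 : Fin (a+1)) = k.succ := fun k => (Fin.succ_ne_zero k).symm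
  refine ⟨fun k => ?_, fun k => ?_, fun i k => ?_⟩
  · simp [pQ, mul_apply, h0]
  · simp [pQ, mul_apply, h0]
  · simp [pQ, mul_apply]

lemma pR_conj {a : ℕ} (c : Fin (a+1) → ℂ) (X : Matrix (Fin (a+1)) (Fin (a+1)) ℂ) (i k : Fin a) :
    ((pR c)ᴴ * X * pR c) i k = X i.succ k.succ - star (c i.succ) * X 0 k.succ
      - X i.succ 0 * c k.succ + star (c i.succ) * X 0 0 * c k.succ := by
  simp [pR, mul_apply, Fin.sum_univ_succ]
  ring

lemma blk_apply' {α β : Type} (ρ : Matrix (α × β) (α × β) ℂ) (i j k l) : ρ (i,j) (k,l) = blk ρ j l i k := rfl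

lemma peel {a : ℕ} {ρ : Matrix (Fin (a+1) × β) (Fin (a+1) × β) ℂ} (h : PPT ρ) (j0 : β)
    (h0 : ∀ j, j ≠ j0 → ρ (0,j) (0,j) = 0) :
    ∃ R : Matrix (Fin (a+1)) (Fin a) ℂ, Sepa (ltr R (1 : Matrix β β ℂ) ρ) → Sepa ρ := by
  have hz1 : ∀ l k j, (l ≠ j0 ∨ j ≠ j0) → ρ (0,l) (k,j) = 0 := by
    rintro l k j (hl | hj)
    · exact (psd_diag_zero h.1 (h0 l hl) _).2
    · exact (psd_diag_zero h.2 (p := (0,j)) (h0 j hj) (k,l)).2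
  have hz2 : ∀ l k j, (l ≠ j0 ∨ j ≠ j0) → ρ (k,j) (0,l) = 0 := fun l k j hlj => by
    rw [← h.1.1.apply, hz1 l k j hlj, star_zero]
  set u := ρ (0,j0) (0,j0) with hu
  have hu0 : 0 ≤ u := h.1.diag_nonneg
  set c : Fin (a+1) → ℂ := fun k => ρ (0,j0) (k,j0) / u with hc
  have hg : ∀ k, ρ (0,j0) (k,j0) = u * c k := fun k => by
    by_cases h1 : u = 0
    · rw [(psd_diag_zero h.1 h1 _).2, h1, zero_mul]
    · simp only [hc]; field_simp
  have hur : star u = u := h.1.1.apply _ _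
  have hg2 : ∀ k, ρ (k,j0) (0,j0) = u * star (c k) := fun k => by
    rw [← h.1.1.apply, hg, star_mul', hur]
  obtain ⟨s, hs⟩ : ∃ s : ℂ, s * star s = u := by
    refine ⟨(Real.sqrt u.re : ℂ), ?_⟩
    have : 0 ≤ u.re := (Complex.nonneg_iff.1 hu0).1
    have h2 : (u.re : ℂ) = u := by
      apply Complex.ext; · simp
      · simpa using (Complex.nonneg_iff.1 hu0).2
    rw [RCLike.star_def, Complex.conj_ofReal, ← Complex.ofReal_mul, Real.mul_self_sqrt this, h2]
  clear_value c
  refine ⟨pR c, fun hsep => ?_⟩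
  have key : ρ = ltr (pQ a) (1 : Matrix β β ℂ) (ltr (pR c) (1 : Matrix β β ℂ) ρ) +
      outer (pv (fun k => star (c k) * s) (Pi.single j0 1)) := by
    ext ⟨i, j⟩ ⟨k, l⟩
    rw [Matrix.add_apply, blk_apply' (ltr _ _ _), blk_ltr, blk_ltr]
    obtain ⟨q1, q2, q3⟩ := pQ_conj ((pR c)ᴴ * blk ρ j l * pR c)
    have ho : outer (pv (fun k => star (c k) * s) (Pi.single j0 (1:ℂ))) (i, j) (k, l) =
        if j = j0 ∧ l = j0 then u * star (c i) * c k else 0 := by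
      by_cases hj : j = j0 <;> by_cases hl : l = j0 <;> simp [outer, pv, hj, hl, Pi.single_apply]
      rw [← hs]; simp; ring
    rw [ho]
    have hc0 : u * c 0 = u := (hg 0).symm
    have hc0' : u * star (c 0) = u := by rw [← hg2]
    by_cases hjl : j = j0 ∧ l = j0
    · obtain ⟨rfl, rfl⟩ := hjl
      rw [if_pos ⟨rfl, rfl⟩]
      cases i using Fin.cases with
      | zero => rw [q1, hg, zero_add, hc0']
      | succ i =>
        cases k using Fin.cases with
        | zero => rw [q2, hg2, mul_right_comm, hc0, zero_add]
        | succ k =>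
          rw [q3, pR_conj]
          simp only [blk, of_apply, hg, hg2, hc0]
          ring
    · rw [if_neg hjl, add_zero]
      have hjl' : j ≠ j0 ∨ l ≠ j0 := by tauto
      cases i using Fin.cases with
      | zero => rw [q1, hz1 _ _ _ hjl']
      | succ i =>
        cases k using Fin.cases with
        | zero => rw [q2, hz2 _ _ _ hjl'.symm]
        | succ k =>
          rw [q3, pR_conj]
          simp only [blk, of_apply, hz1 _ _ _ hjl', hz2 _ _ _ hjl'.symm]
          ring
  rw [key]
  exact (hsep.ltr _ _).add (sep_outer _ _)

end

/-- unit with given first column -/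
lemma exists_col {a : ℕ} {v : Fin (a+1) → ℂ} (hv : v ≠ 0) :
    ∃ S : Matrix (Fin (a+1)) (Fin (a+1)) ℂ, IsUnit S ∧ S *ᵥ (Pi.single 0 1) = v := by
  obtain ⟨A, hA⟩ := SeparatingDual.exists_continuousLinearEquiv_apply_eq (R := ℂ)
    (x := (Pi.single 0 1 : Fin (a+1) → ℂ)) (y := v) (by
      intro h; simpa using congrFun h 0) hv
  refine ⟨LinearMap.toMatrix' (A : (Fin (a+1) → ℂ) →ₗ[ℂ] (Fin (a+1) → ℂ)), ?_, ?_⟩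
  · refine IsUnit.of_mul_eq_one (LinearMap.toMatrix'
      (A.symm : (Fin (a+1) → ℂ) →ₗ[ℂ] (Fin (a+1) → ℂ))) ?_
    rw [← LinearMap.toMatrix'_mul]
    convert LinearMap.toMatrix'_one
    ext x; simp
  · rw [← hA, LinearMap.toMatrix'_mulVec]; rfl

/-- product kernel vector leads to peel, when second factor is two dim -/
lemma ltr_ker {α β : Type} [Fintype α] [Fintype β] [DecidableEq α] [DecidableEq β] 
    {S : Matrix α α ℂ} {T : Matrix β β ℂ} {ρ : Matrix (α × β) (α × β) ℂ} {i : α} {j : β}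
    (h : ρ *ᵥ (pv (S *ᵥ Pi.single i 1) (T *ᵥ Pi.single j 1)) = 0) : ltr S T ρ (i,j) (i,j) = 0 := by
  have : ltr S T ρ *ᵥ pv (Pi.single i 1) (Pi.single j 1) = 0 := by
    rw [ltr, ← mulVec_mulVec, kron_pv, ← mulVec_mulVec, h, mulVec_zero]
  have h2 : pv (Pi.single i (1:ℂ)) (Pi.single j (1:ℂ)) = Pi.single (i,j) 1 := by
    ext ⟨x, y⟩
    by_cases hx : x = i <;> by_cases hy : y = j <;> simp [pv, hx, hy]
  rw [h2] at this
  simpa using congrFun this (i,j)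

lemma peel2 {a : ℕ} {ρ : Matrix (Fin (a+1) × Fin 2) (Fin (a+1) × Fin 2) ℂ} (h : PPT ρ)
    {v w} (hv : v ≠ 0) (hw : w ≠ 0) (hz : ρ *ᵥ pv v w = 0) :
    ∃ ρ' : Matrix (Fin a × Fin 2) (Fin a × Fin 2) ℂ, PPT ρ' ∧ ρ'.rank ≤ ρ.rank ∧ (Sepa ρ' → Sepa ρ) := by
  obtain ⟨S, hS, rfl⟩ := exists_col hv
  obtain ⟨T, hT, rfl⟩ := exists_col hw
  obtain ⟨R, hR⟩ := peel (h.ltr S T) 1 (fun j hj => by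
    have : j = 0 := by fin_cases j <;> simp_all
    subst this
    exact ltr_ker hz)
  exact ⟨_, (h.ltr S T).ltr R 1, (rank_ltr_le _ _ _).trans (rank_ltr_le _ _ _),
    fun h' => sep_of_ltr hS hT (hR h')⟩

lemma sep_1 {β : Type} [Fintype β] [DecidableEq β] {ρ : Matrix (Fin 1 × β) (Fin 1 × β) ℂ} (h : ρ.PosSemidef) : Sepa ρ := by
  obtain ⟨F, hF⟩ := gram h le_rfl
  refine sep_sum (ι := Fin ρ.rank) (fun _ _ => 1) (fun t j => star (F t (0,j))) ?_
  rintro ⟨i, j⟩ ⟨k, l⟩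
  obtain rfl := Subsingleton.elim i 0
  obtain rfl := Subsingleton.elim k 0
  conv_lhs => rw [hF]
  simp [mul_apply]

lemma blk_mulVec {α β : Type} [Fintype α] [Fintype β] [DecidableEq β] (ρ : Matrix (α × β) (α × β) ℂ) (j : β) (x : α → ℂ) (p) :
    (ρ *ᵥ pv x (Pi.single j 1)) p = (blk ρ p.2 j *ᵥ x) p.1 := by
  simp [mulVec, dotProduct, pv, blk, Fintype.sum_prod_type, Pi.single_apply]

lemma blk_posDef {α β : Type} [Fintype α] [DecidableEq α] [Fintype β] [DecidableEq β] {ρ : Matrix (α × β) (α × β) ℂ}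
    (h : ρ.PosSemidef) (j : β) (hk : ∀ v w, ρ *ᵥ pv v w = 0 → v = 0 ∨ w = 0) : (blk ρ j j).PosDef := by
  refine posDef_of (h.submatrix (fun i => (i, j))) fun x hx => ?_
  have : ρ *ᵥ pv x (Pi.single j 1) = 0 := by
    apply psd_ker h
    simp only [dotProduct, blk_mulVec]
    refine Finset.sum_eq_zero fun p _ => ?_
    by_cases hp : p.2 = j
    · rw [hp, hx]; simp
    · simp [pv, hp]
  rcases hk _ _ this with h1 | h1
  · exact h1
  · simpa using congrFun h1 j


lemma rank_add_le' {n : Type} [Fintype n] (A B : Matrix n n ℂ) : (A + B).rank ≤ A.rank + B.rank := by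
  unfold Matrix.rank
  rw [mulVecLin_add]
  refine (Submodule.finrank_mono (LinearMap.range_add_le _ _)).trans ?_
  exact Submodule.finrank_add_le_finrank_add_finrank _ _

lemma rank_blk {a : ℕ} {β : Type} [Fintype β] [DecidableEq β] {ρ : Matrix (Fin a × β) (Fin a × β) ℂ} {j : β}
    (h : (blk ρ j j).PosDef) : a ≤ ρ.rank := by
  have h1 : (blk ρ j j).rank = a := by
    rw [rank_of_isUnit _ h.isUnit]; simp
  refine h1.symm.le.trans ?_
  exact rank_submatrix_le ρ (fun i => (i,j)) (fun i => (i, j))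

lemma rank_outer_le {n : Type} [Fintype n] (u : n → ℂ) : (outer u).rank ≤ 1 := by
  rw [outer_eq]; exact rank_vecMulVec_le _ _

lemma outer_herm {n : Type} [Fintype n] (u : n → ℂ) : (outer u).IsHermitian := (outer_psd u).1

lemma ker_of_full {n : Type} [Fintype n] [DecidableEq n] {M : Matrix n n ℂ} (h : M.rank = Fintype.card n) {z : n → ℂ}
    (hz : M *ᵥ z = 0) : z = 0 := by
  have h1 := LinearMap.finrank_range_add_finrank_ker M.mulVecLin
  rw [← Matrix.rank, h] at h1
  have h2 : Module.finrank ℂ (LinearMap.ker M.mulVecLin) = 0 := by simpa using h1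
  have h3 := Submodule.finrank_eq_zero.1 h2
  have : z ∈ LinearMap.ker M.mulVecLin := by simpa using hz
  rw [h3] at this
  simpa using this

lemma full_perturb {α β : Type} [Fintype α] [Fintype β] [DecidableEq α] [DecidableEq β]
    {ρ : Matrix (α × β) (α × β) ℂ} (h : PPT ρ) (h2 : 2 ≤ ρ.rank)
    (hk : ∀ z, pt ρ *ᵥ z = 0 → z = 0) :
    ∃ ρ1 ρ2, ρ = ρ1 + ρ2 ∧ PPT ρ1 ∧ PPT ρ2 ∧ ρ1.rank ≤ ρ.rank ∧ ρ2.rank ≤ ρ.rank ∧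
      ρ1.rank + (pt ρ1).rank < ρ.rank + (pt ρ).rank ∧
      ρ2.rank + (pt ρ2).rank < ρ.rank + (pt ρ).rank := by
  obtain ⟨p, hp⟩ : ∃ p, ρ *ᵥ Pi.single p 1 ≠ 0 := by
    by_contra! hcon
    have : ρ = 0 := by
      ext i j
      simpa using congrFun (hcon j) i
    rw [this, rank_zero] at h2; omega
  refine perturb h (outer_herm (ρ *ᵥ Pi.single p 1)) (fun z hz => ?_) (fun z hz => ?_) fun c hc => ?_
  · rw [outer_eq, star_mulVec, h.1.1, ← vecMulVec_mul, ← mulVec_mulVec, hz, mulVec_zero]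
  · rw [hk z hz, mulVec_zero]
  · by_cases hc0 : c = 0
    · rw [hc0, zero_smul] at hc
      apply hp
      ext q
      have := congrFun (congrFun hc q) q
      simpa [outer] using this
    · have h3 := rank_outer_le (ρ *ᵥ Pi.single p 1)
      have h4 : ρ = c⁻¹ • outer (ρ *ᵥ Pi.single p 1) := by rw [hc, smul_smul, inv_mul_cancel₀ hc0, one_smul]
      have h5 : ρ.rank ≤ (outer (ρ *ᵥ Pi.single p 1)).rank := by
        refine (rank_le_of_ker fun z hz => ?_).1
        rw [h4, smul_mulVec, hz, smul_zero]
      omega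

lemma comp2 {ρ : Matrix (Fin 2 × Fin 2) (Fin 2 × Fin 2) ℂ} (h : PPT ρ)
    (hr : ρ.rank ≤ 3) (hs : (pt ρ).rank ≤ 3) (h1 : (blk ρ 0 0).PosDef) : Sepa ρ := by
  let S : Matrix (Fin 2) (Fin 3) ℂ := !![1, 0, 0; 0, 1, 0]
  let Q : Matrix (Fin 3) (Fin 2) ℂ := !![1, 0; 0, 1; 0, 0]
  let e2 : Fin 3 → ℂ := ![0, 0, 1]
  let e0 : Fin 2 → ℂ := ![1, 0]
  set τ := ltr S (1 : Matrix (Fin 2) (Fin 2) ℂ) ρ + outer (pv e2 e0) with hτ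
  have hpt : pt τ = ltr S (1 : Matrix (Fin 2) (Fin 2) ℂ) (pt ρ) + outer (pv e2 (star e0)) := by
    rw [hτ, pt_add, pt_outer, pt_ltr]
    congr 2
    ext i j; fin_cases i <;> fin_cases j <;> simp
  have hτP : PPT τ := (h.ltr _ _).add (PPT.outer _ _)
  have hτr : τ.rank ≤ 4 := (rank_add_le' _ _).trans (by
    have := rank_ltr_le S (1 : Matrix (Fin 2) (Fin 2) ℂ) ρ
    have := rank_outer_le (pv e2 e0)
    omega)
  have hτs : (pt τ).rank ≤ 4 := by
    rw [hpt]
    refine (rank_add_le' _ _).trans ?_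
    have := rank_ltr_le S (1 : Matrix (Fin 2) (Fin 2) ℂ) (pt ρ)
    have := rank_outer_le (pv e2 (star e0))
    omega
  have hb : blk τ 0 0 = Sᴴ * blk ρ 0 0 * S + outer e2 := by
    rw [← blk_ltr]
    ext i k
    simp [blk, hτ, outer, pv, e0]
  have hpd : (blk τ 0 0).PosDef := by
    refine posDef_of (hτP.1.submatrix (fun i => (i, 0))) fun x hx => ?_
    rw [hb] at hx
    have hb0 := hx
    have h3 : x 2 = 0 := by
      have := congrFun hx 2
      simpa [add_mulVec, mulVec, dotProduct, Fin.sum_univ_three, mul_apply, S, outer, e2] using this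
    have h4 : blk ρ 0 0 *ᵥ ![x 0, x 1] = 0 := by
      ext i
      fin_cases i
      · have := congrFun hx 0
        simpa [add_mulVec, mulVec, dotProduct, Fin.sum_univ_three, mul_apply, S, outer, e2] using this
      · have := congrFun hx 1
        simpa [add_mulVec, mulVec, dotProduct, Fin.sum_univ_three, mul_apply, S, outer, e2] using this
    have h5 : ![x 0, x 1] = 0 := by
      by_contra hne
      have := h1.dotProduct_mulVec_pos hne
      rw [h4] at this; simp at this
    ext i; fin_cases i
    · simpa using congrFun h5 0
    · simpa using congrFun h5 1
    · simpa using h3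
  have hsep := (comp3 hτP hτr hτs hpd).ltr Q (1 : Matrix (Fin 2) (Fin 2) ℂ)
  have : ltr Q (1 : Matrix (Fin 2) (Fin 2) ℂ) τ = ρ := by
    ext ⟨i, j⟩ ⟨k, l⟩
    rw [blk_apply' (ltr Q (1 : Matrix (Fin 2) (Fin 2) ℂ) τ), blk_ltr, blk_apply' ρ]
    have : blk τ j l = Sᴴ * blk ρ j l * S + (e0 j * star (e0 l)) • outer e2 := by
      rw [← blk_ltr]
      ext i k
      simp [blk, hτ, outer, pv]; ring
    rw [this]
    fin_cases i <;> fin_cases k <;>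
    simp [mul_apply, Fin.sum_univ_three, Q, S, outer, e2]
  rwa [this] at hsep

theorem woron2 (n : ℕ) : ∀ ρ : Matrix (Fin 2 × Fin 2) (Fin 2 × Fin 2) ℂ, PPT ρ →
    ρ.rank + (pt ρ).rank = n → Sepa ρ := by
  induction n using Nat.strong_induction_on with
  | _ n ih =>
  intro ρ h hn
  by_cases hk : ∃ v w, v ≠ 0 ∧ w ≠ 0 ∧ ρ *ᵥ pv v w = 0
  · obtain ⟨v, w, hv, hw, hz⟩ := hk
    obtain ⟨ρ', h1, _, h3⟩ := peel2 h hv hw hz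
    exact h3 (sep_1 h1.1)
  · have hk' : ∀ v w, ρ *ᵥ pv v w = 0 → v = 0 ∨ w = 0 := fun v w hz => by
      by_contra hcon
      push Not at hcon
      exact hk ⟨v, w, hcon.1, hcon.2, hz⟩
    have hb := blk_posDef h.1 0 hk'
    have hr2 := rank_blk hb
    have hs2 : 2 ≤ (pt ρ).rank := rank_blk (ρ := pt ρ) (j := 0) hb
    have hrc : ρ.rank ≤ 4 := by simpa using ρ.rank_le_card_width
    have hsc : (pt ρ).rank ≤ 4 := by simpa using (pt ρ).rank_le_card_width
    by_cases hs : (pt ρ).rank = 4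
    · obtain ⟨ρ1, ρ2, he, p1, p2, -, -, l1, l2⟩ := full_perturb h hr2 (fun z hz => ker_of_full (by simp [hs]) hz)
      rw [he]
      exact (ih _ (hn ▸ l1) ρ1 p1 rfl).add (ih _ (hn ▸ l2) ρ2 p2 rfl)
    · by_cases hr : ρ.rank = 4
      · obtain ⟨ρ1, ρ2, he, p1, p2, -, -, l1, l2⟩ := full_perturb h.pt hs2 (fun z hz => by
          rw [pt_pt] at hz
          exact ker_of_full (by simp [hr]) hz)
        rw [pt_pt] at l1 l2
        apply sep_of_pt
        rw [he]
        exact (ih _ (by omega) ρ1 p1 rfl).add (ih _ (by omega) ρ2 p2 rfl)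
      · exact comp2 h (by omega) (by omega) hb


lemma pt_conjT {α β : Type} (M : Matrix (α × β) (α × β) ℂ) : pt Mᴴ = (pt M)ᴴ := by
  ext p q; simp [pt]

lemma ker_span {n : Type} [Fintype n] [DecidableEq n] {M : Matrix n n ℂ} (h : Fintype.card n ≤ M.rank + 1) :
    ∃ w, ∀ z, M *ᵥ z = 0 → ∃ t : ℂ, z = t • w := by
  have h1 := LinearMap.finrank_range_add_finrank_ker M.mulVecLin
  rw [← Matrix.rank] at h1
  have h2 : Module.finrank ℂ (LinearMap.ker M.mulVecLin) ≤ 1 := by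
    simp at h1; omega
  obtain ⟨⟨w, hw⟩, hw'⟩ := finrank_le_one_iff.1 h2
  refine ⟨w, fun z hz => ?_⟩
  obtain ⟨t, ht⟩ := hw' ⟨z, by simpa using hz⟩
  exact ⟨t, by simpa using (congrArg Subtype.val ht).symm⟩

lemma exists_h (F : Matrix (Fin 4) (Fin 3 × Fin 2) ℂ) (w : Fin 3 × Fin 2 → ℂ) :
    ∃ h : Matrix (Fin 4) (Fin 4) ℂ, h ≠ 0 ∧ h.IsHermitian ∧ h.trace = 0 ∧
      pt (Fᴴ * h * F) *ᵥ w = 0 := by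
  let L : Matrix (Fin 4) (Fin 4) ℂ →ₗ[ℂ] ℂ × (Fin 3 × Fin 2 → ℂ) × (Fin 3 × Fin 2 → ℂ) :=
    { toFun := fun h => (h.trace, pt (Fᴴ * h * F) *ᵥ w, star w ᵥ* pt (Fᴴ * h * F))
      map_add' := fun a b => by
        simp [Matrix.mul_add, Matrix.add_mul, pt_add, add_mulVec, vecMul_add]
      map_smul' := fun c a => by
        simp [pt_smul, smul_mulVec, vecMul_smul] }
  have := LinearMap.ker_ne_bot_of_finrank_lt (f := L) (by
    simp [Module.finrank_matrix])
  obtain ⟨g, hg, hg0⟩ := Submodule.exists_mem_ne_zero_of_ne_bot this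
  have hg1 : L g = 0 := by simpa using hg
  have e1 : g.trace = 0 := congrArg Prod.fst hg1
  have e2 : pt (Fᴴ * g * F) *ᵥ w = 0 := congrArg (fun x => x.2.1) hg1
  have e3 : star w ᵥ* pt (Fᴴ * g * F) = 0 := congrArg (fun x => x.2.2) hg1
  have e4 : pt (Fᴴ * gᴴ * F) *ᵥ w = 0 := by
    have : Fᴴ * gᴴ * F = (Fᴴ * g * F)ᴴ := by
      simp [conjTranspose_mul, Matrix.mul_assoc]
    rw [this, pt_conjT]
    have h5 := congrArg star e3
    rwa [star_vecMul, star_star, star_zero] at h5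
  by_cases hs : g + gᴴ = 0
  · refine ⟨Complex.I • g, by simpa using hg0, ?_, by simp [e1], ?_⟩
    · rw [IsHermitian, conjTranspose_smul]
      have : gᴴ = - g := eq_neg_of_add_eq_zero_right hs
      rw [this]; simp
    · rw [Matrix.mul_smul, Matrix.smul_mul, pt_smul, smul_mulVec, e2, smul_zero]
  · refine ⟨g + gᴴ, hs, isHermitian_add_transpose_self g, ?_, ?_⟩
    · rw [trace_add, trace_conjTranspose, e1]; simp
    · rw [Matrix.mul_add, Matrix.add_mul, pt_add, add_mulVec, e2, e4, add_zero]

theorem woron3 (n : ℕ) : ∀ ρ : Matrix (Fin 3 × Fin 2) (Fin 3 × Fin 2) ℂ, PPT ρ → ρ.rank ≤ 4 →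
    ρ.rank + (pt ρ).rank = n → Sepa ρ := by
  induction n using Nat.strong_induction_on with
  | _ n ih =>
  intro ρ h hr4 hn
  by_cases hk : ∃ v w, v ≠ 0 ∧ w ≠ 0 ∧ ρ *ᵥ pv v w = 0
  · obtain ⟨v, w, hv, hw, hz⟩ := hk
    obtain ⟨ρ', h1, _, h3⟩ := peel2 h hv hw hz
    exact h3 (woron2 _ _ h1 rfl)
  · have hk' : ∀ v w, ρ *ᵥ pv v w = 0 → v = 0 ∨ w = 0 := fun v w hz => by
      by_contra hcon
      push Not at hcon
      exact hk ⟨v, w, hcon.1, hcon.2, hz⟩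
    have hb := blk_posDef h.1 0 hk'
    by_cases hr : ρ.rank ≤ 3
    · exact compNormal h hr hb
    by_cases hs : (pt ρ).rank ≤ 4
    · exact comp3 h hr4 hs hb
    have hr' : ρ.rank = 4 := by omega
    obtain ⟨F, G, hF, hG⟩ := gram_surj h.1 hr'
    obtain ⟨w, hw⟩ := ker_span (M := pt ρ) (by simp; omega)
    obtain ⟨g, g0, gH, gt, gw⟩ := exists_h F w
    have hGF : Gᴴ * Fᴴ = 1 := by rw [← conjTranspose_mul, hG, conjTranspose_one]
    obtain ⟨ρ1, ρ2, he, p1, p2, m1, m2, l1, l2⟩ := perturb (H := Fᴴ * g * F) h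
      (isHermitian_conjTranspose_mul_mul F gH) (fun z hz => by
        have : F *ᵥ z = 0 := by
          have h5 := congrArg (fun x => Gᴴ *ᵥ x) hz
          simp only [mulVec_zero] at h5
          rwa [hF, mulVec_mulVec, ← Matrix.mul_assoc, hGF, Matrix.one_mul] at h5
        rw [← mulVec_mulVec, this, mulVec_zero])
      (fun z hz => by
        obtain ⟨t, rfl⟩ := hw z hz
        rw [mulVec_smul, gw, smul_zero])
      (fun c hc => by
        have h6 : g = c • (1 : Matrix (Fin 4) (Fin 4) ℂ) := by
          have h5 := congrArg (fun X => Gᴴ * X * G) hc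
          simp only [hF] at h5
          have e1 : Gᴴ * (Fᴴ * g * F) * G = (Gᴴ * Fᴴ) * g * (F * G) := by simp only [Matrix.mul_assoc]
          have e2 : Gᴴ * (c • (Fᴴ * F)) * G = c • ((Gᴴ * Fᴴ) * (F * G)) := by
            simp only [Matrix.mul_assoc, Matrix.mul_smul, Matrix.smul_mul]
          rw [e1, e2, hG, hGF] at h5
          simpa using h5
        rw [h6] at gt
        have hc0 : c = 0 := by simpa using gt
        rw [hc0] at h6
        exact g0 (by simpa using h6))
    rw [he]
    exact (ih _ (by omega) ρ1 p1 (by omega) rfl).add (ih _ (by omega) ρ2 p2 (by omega) rfl)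


noncomputable def Dd {R : Type} [CommRing R] (N : Matrix (Fin 3) (Fin 3) R) (n : Fin 3 → R) : Matrix (Fin 3) (Fin 3) R :=
  of ![n, n ᵥ* N, (n ᵥ* N) ᵥ* N]

lemma Dd_map {R S : Type} [CommRing R] [CommRing S] (f : R →+* S) (N : Matrix (Fin 3) (Fin 3) R) (n : Fin 3 → R) :
    (Dd N n).map f = Dd (N.map f) (f ∘ n) := by
  ext i j
  fin_cases i
  · simp [Dd]
  · simp [Dd, RingHom.map_vecMul]
  · simp only [Dd, map_apply, of_apply]
    change f ((n ᵥ* N ᵥ* N) j) = (((f ∘ n) ᵥ* N.map f) ᵥ* N.map f) j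
    rw [RingHom.map_vecMul]
    congr 2
    ext k
    exact RingHom.map_vecMul f _ _ k

lemma Dd_smul (c : ℂ) (N : Matrix (Fin 3) (Fin 3) ℂ) (n : Fin 3 → ℂ) :
    (Dd (c • N) (c • n)).det = c ^ 6 * (Dd N n).det := by
  have : Dd (c • N) (c • n) = diagonal ![c, c^2, c^3] * Dd N n := by
    ext i j
    rw [diagonal_mul]
    fin_cases i
    · simp [Dd]
    · simp [Dd, vecMul_smul, smul_vecMul, smul_smul]; left; ring
    · simp [Dd, vecMul_smul, smul_vecMul, smul_smul]; left; ring
  rw [this, det_mul, det_diagonal, Fin.prod_univ_three]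
  simp; left; ring

open Polynomial in
lemma Dd_zero (N0 N1 : Matrix (Fin 3) (Fin 3) ℂ) (n0 n1 : Fin 3 → ℂ) :
    ∃ a b : ℂ, (a ≠ 0 ∨ b ≠ 0) ∧ (Dd (a • N0 + b • N1) (a • n0 + b • n1)).det = 0 := by
  have key : ∀ (N0 N1 : Matrix (Fin 3) (Fin 3) ℂ) (n0 n1 : Fin 3 → ℂ), ∃ p : ℂ[X], ∀ t,
      p.eval t = (Dd (N0 + t • N1) (n0 + t • n1)).det := by
    intro N0 N1 n0 n1
    refine ⟨(Dd (N0.map C + (X : ℂ[X]) • N1.map C) (C ∘ n0 + (X : ℂ[X]) • (C ∘ n1))).det, fun t => ?_⟩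
    rw [← coe_evalRingHom, RingHom.map_det, RingHom.mapMatrix_apply, Dd_map]
    congr 2
    · ext i j; simp; ring
    · ext i; simp; ring
  obtain ⟨p, hp⟩ := key N0 N1 n0 n1
  by_cases hd : p.degree = 0
  · obtain ⟨q, hq⟩ := key N1 N0 n1 n0
    rw [eq_C_of_degree_eq_zero hd] at hp
    set c := p.coeff 0
    have h1 : X * q = X * (C c * X ^ 6) := by
      apply Polynomial.funext
      intro s
      by_cases hs : s = 0
      · simp [hs]
      · have h2 := hp s⁻¹
        have h3 := Dd_smul s (N0 + s⁻¹ • N1) (n0 + s⁻¹ • n1)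
        rw [smul_add, smul_smul, mul_inv_cancel₀ hs, one_smul, smul_add, smul_smul,
          mul_inv_cancel₀ hs, one_smul, ← h2, add_comm, add_comm (s • n0), ← hq] at h3
        simp only [eval_mul, eval_X, eval_C, eval_pow, h3]; ring
    have h4 := mul_left_cancel₀ X_ne_zero h1
    refine ⟨0, 1, Or.inr one_ne_zero, ?_⟩
    have h5 := hq 0
    rw [h4] at h5
    simpa using h5.symm
  · obtain ⟨t, ht⟩ := IsAlgClosed.exists_root p hd
    refine ⟨1, t, Or.inl one_ne_zero, ?_⟩
    rw [one_smul, one_smul, ← hp]; exact ht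

lemma eig_of_Dd (N : Matrix (Fin 3) (Fin 3) ℂ) (n : Fin 3 → ℂ) (h : (Dd N n).det = 0) :
    ∃ (y : Fin 3 → ℂ) (lam : ℂ), y ≠ 0 ∧ N *ᵥ y = lam • y ∧ n ⬝ᵥ y = 0 := by
  obtain ⟨y0, hy0, hy1⟩ := exists_mulVec_eq_zero_iff.2 h
  let W : Submodule ℂ (Fin 3 → ℂ) := LinearMap.ker (Dd N n).mulVecLin
  have hW : ∀ y, y ∈ W ↔ n ⬝ᵥ y = 0 ∧ n ⬝ᵥ (N *ᵥ y) = 0 ∧ n ⬝ᵥ (N *ᵥ (N *ᵥ y)) = 0 := by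
    intro y
    have : y ∈ W ↔ (Dd N n) *ᵥ y = 0 := by simp [W]
    rw [this, funext_iff, Fin.forall_fin_succ, Fin.forall_fin_succ, Fin.forall_fin_one]
    simp only [dotProduct_mulVec]
    rfl
  have hch : ∃ a b c : ℂ, N ^ 3 + (a • 1 + b • N + c • N ^ 2) = 0 := by
    have h1 := aeval_self_charpoly N
    rw [N.charpoly_monic.as_sum, charpoly_natDegree_eq_dim] at h1
    simp [Finset.sum_range_succ, Algebra.algebraMap_eq_smul_one] at h1
    exact ⟨_, _, _, h1⟩
  obtain ⟨a, b, c, hch⟩ := hch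
  have hinv : ∀ y ∈ W, N.mulVecLin y ∈ W := by
    intro y hy
    rw [hW] at hy ⊢
    obtain ⟨h1, h2, h3⟩ := hy
    refine ⟨h2, h3, ?_⟩
    have h5 := congrArg (fun X => n ⬝ᵥ (X *ᵥ y)) hch
    simp only [add_mulVec, smul_mulVec, one_mulVec, dotProduct_add, dotProduct_smul, pow_succ, pow_zero, one_mul, h1, h2,
      ← mulVec_mulVec, h3, zero_mulVec, dotProduct_zero, smul_zero, add_zero] at h5
    simpa using h5
  have hnt : Nontrivial W := ⟨⟨0, ⟨y0, by simpa [W] using hy1⟩, fun hh => hy0 (congrArg Subtype.val hh).symm⟩⟩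
  obtain ⟨lam, hl⟩ := Module.End.exists_eigenvalue (N.mulVecLin.restrict hinv)
  obtain ⟨⟨y, hyW⟩, hy⟩ := hl.exists_hasEigenvector
  refine ⟨y, lam, fun hh => hy.2 (by ext1; exact hh), ?_, ((hW y).1 hyW).1⟩
  have := congrArg Subtype.val hy.apply_eq_smul
  simpa using this

lemma prod_ker_norm (A B C : Matrix (Fin 4) (Fin 3) ℂ) (hC : Cᴴ * C = 1) :
    ∃ (a b c : ℂ) (y : Fin 3 → ℂ), (a ≠ 0 ∨ b ≠ 0) ∧ y ≠ 0 ∧ (a • A + b • B + c • C) *ᵥ y = 0 := by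
  obtain ⟨q, hq⟩ := complete_col hC
  obtain ⟨a, b, hab, hd⟩ := Dd_zero (Cᴴ * A) (Cᴴ * B) (star q ᵥ* A) (star q ᵥ* B)
  obtain ⟨y, lam, hy, h1, h2⟩ := eig_of_Dd _ _ hd
  refine ⟨a, b, -lam, y, hab, hy, ?_⟩
  have e1 : Cᴴ *ᵥ ((a • A + b • B) *ᵥ y) = lam • y := by
    rw [← h1, mulVec_mulVec, Matrix.mul_add, Matrix.mul_smul, Matrix.mul_smul]
  have e2 : star q ⬝ᵥ ((a • A + b • B) *ᵥ y) = 0 := by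
    rw [← h2, dotProduct_mulVec, vecMul_add, vecMul_smul, vecMul_smul]
  have e3 : (a • A + b • B) *ᵥ y = lam • (C *ᵥ y) := by
    conv_lhs => rw [← one_mulVec ((a • A + b • B) *ᵥ y), ← hq, add_mulVec, ← mulVec_mulVec, e1, outer_eq,
      vecMulVec_mulVec, e2, mulVec_smul]
    simp
  rw [add_mulVec, e3, smul_mulVec, neg_smul, add_neg_cancel]

theorem prod_ker (F : Matrix (Fin 4) (Fin 3 × Fin 3) ℂ) : ∃ v w, v ≠ 0 ∧ w ≠ 0 ∧ F *ᵥ pv v w = 0 := by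
  let Fi : Fin 3 → Matrix (Fin 4) (Fin 3) ℂ := fun i => of fun x j => F x (i, j)
  have hF : ∀ v w, F *ᵥ pv v w = (v 0 • Fi 0 + v 1 • Fi 1 + v 2 • Fi 2) *ᵥ w := by
    intro v w
    ext x
    simp [mulVec, dotProduct, Fintype.sum_prod_type, Fin.sum_univ_three, pv, Fi]
    ring
  by_cases hC : ∃ y, y ≠ 0 ∧ Fi 2 *ᵥ y = 0
  · obtain ⟨y, hy, hz⟩ := hC
    refine ⟨![0, 0, 1], y, fun h => by simpa using congrFun h 2, hy, ?_⟩
    rw [hF]; simpa using hz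
  · push Not at hC
    have hpd : ((Fi 2)ᴴ * Fi 2).PosDef := posDef_of (posSemidef_conjTranspose_mul_self _) fun x hx => by
      by_contra hne
      exact hC x hne ((conjTranspose_mul_self_mulVec_eq_zero _ _).1 hx)
    obtain ⟨S, hS, hS1⟩ := norm_one hpd
    obtain ⟨a, b, c, y, hab, hy, h0⟩ := prod_ker_norm (Fi 0 * S) (Fi 1 * S) (Fi 2 * S) (by
      rw [conjTranspose_mul, ← hS1]; simp only [Matrix.mul_assoc])
    refine ⟨![a, b, c], S *ᵥ y, fun h => ?_, fun h => ?_, ?_⟩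
    · rcases hab with h' | h'
      · exact h' (by simpa using congrFun h 0)
      · exact h' (by simpa using congrFun h 1)
    · apply hy
      have := congrArg (fun x => S⁻¹ *ᵥ x) h
      simpa [mulVec_mulVec, nonsing_inv_mul _ ((isUnit_iff_isUnit_det _).1 hS)] using this
    · rw [hF, mulVec_mulVec, ← h0]
      simp [Matrix.add_mul]


section
variable {n m : Type} [Fintype n] [DecidableEq n] [Fintype m] [DecidableEq m]

lemma schur_c {M : Matrix n n ℂ} {c : m → n} {r : ℕ} {F : Matrix (Fin r) n ℂ} (hF : M = Fᴴ * F)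
    (hc : M.submatrix c c = 1) :
    (F.submatrix id c)ᴴ * F.submatrix id c = 1 ∧ M - M.submatrix id c * M.submatrix c id =
      ((1 - F.submatrix id c * (F.submatrix id c)ᴴ) * F)ᴴ * ((1 - F.submatrix id c * (F.submatrix id c)ᴴ) * F) := by
  set W := F.submatrix id c with hW
  have hWW : Wᴴ * W = 1 := by
    rw [← hc, hF]; rfl
  refine ⟨hWW, ?_⟩
  have e1 : M.submatrix id c = Fᴴ * W := by rw [hF]; rfl
  have e2 : M.submatrix c id = Wᴴ * F := by rw [hF]; rfl
  have e3 : (1 - W * Wᴴ)ᴴ * (1 - W * Wᴴ) = 1 - W * Wᴴ := by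
    have : W * Wᴴ * (W * Wᴴ) = W * Wᴴ := by
      rw [Matrix.mul_assoc, ← Matrix.mul_assoc Wᴴ, hWW, Matrix.one_mul]
    simp [Matrix.mul_sub, Matrix.sub_mul, this]
  rw [conjTranspose_mul, Matrix.mul_assoc, ← Matrix.mul_assoc _ _ F, e3, e1, e2]
  conv_lhs => rw [hF]
  simp only [Matrix.mul_sub, Matrix.sub_mul, Matrix.one_mul, Matrix.mul_assoc]

lemma schur_c_psd {M : Matrix n n ℂ} {c : m → n} (h : M.PosSemidef) (hc : M.submatrix c c = 1) :
    (M - M.submatrix id c * M.submatrix c id).PosSemidef := by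
  obtain ⟨F, hF⟩ := gram h le_rfl
  rw [(schur_c hF hc).2]
  exact posSemidef_conjTranspose_mul_self _

lemma schur_c_eq {M : Matrix n n ℂ} {c : m → n} (h : M.PosSemidef) (hc : M.submatrix c c = 1)
    (hr : M.rank ≤ Fintype.card m) : M = M.submatrix id c * M.submatrix c id := by
  obtain ⟨F, hF⟩ := gram h hr
  obtain ⟨h1, h2⟩ := schur_c hF hc
  have h3 := (mul_eq_one_comm_of_card_eq _ _ ℂ (by simp)).1 h1
  rw [h3, sub_self, Matrix.zero_mul, Matrix.mul_zero, sub_eq_zero] at h2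
  exact h2

end

abbrev M9 := Matrix (Fin 3 × Fin 3) (Fin 3 × Fin 3) ℂ

def cc : Fin 2 ⊕ Fin 2 → Fin 3 × Fin 3 := Sum.elim (fun x => (0, x.succ)) (fun x => (x.succ, 0))

structure NF (ρ : M9) : Prop where
  ppt : PPT ρ
  rk : ρ.rank ≤ 4
  z : ρ (0,0) (0,0) = 0
  hB : ∀ j l : Fin 2, ρ (0,j.succ) (0,l.succ) = if j = l then 1 else 0
  hA : ∀ j l : Fin 2, ρ (j.succ,0) (l.succ,0) = if j = l then 1 else 0

namespace NF
variable {ρ : M9} (h : NF ρ)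
include h

lemma z1 (q) : ρ q (0,0) = 0 := (psd_diag_zero h.ppt.1 h.z q).1
lemma z2 (q) : ρ (0,0) q = 0 := (psd_diag_zero h.ppt.1 h.z q).2
lemma z3 (i j) : ρ (i,0) (0,j) = 0 := (psd_diag_zero h.ppt.2 (p := (0,0)) h.z (i,j)).1
lemma z4 (i j) : ρ (0,j) (i,0) = 0 := (psd_diag_zero h.ppt.2 (p := (0,0)) h.z (i,j)).2

lemma c1 : ρ.submatrix cc cc = 1 := by
  ext (i | i) (j | j)
  · simp [cc, h.hB, one_apply]
  · simp [cc, h.z4]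
  · simp [cc, h.z3]
  · simp [cc, h.hA, one_apply]

lemma c2 : (pt ρ).submatrix cc cc = 1 := by
  ext (i | i) (j | j)
  · simp [cc, pt, h.hB, one_apply, eq_comm]
  · simp [cc, pt, h.z2]
  · simp [cc, pt, h.z1]
  · simp [cc, pt, h.hA, one_apply]

lemma r0 : ρ = ρ.submatrix id cc * ρ.submatrix cc id :=
  schur_c_eq h.ppt.1 h.c1 (by simpa using h.rk)

lemma r0' (p q) : ρ p q = ∑ x : Fin 2, ρ p (0, x.succ) * ρ (0, x.succ) q +
    ∑ x : Fin 2, ρ p (x.succ, 0) * ρ (x.succ, 0) q := by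
  conv_lhs => rw [h.r0]
  simp [mul_apply, cc]

lemma r1 : pt ρ = (pt ρ).submatrix id cc * (pt ρ).submatrix cc id := by
  have h1 := schur_c_psd h.ppt.2 h.c2
  have h2 := h1.trace_eq_zero_iff.1 ?_
  · exact sub_eq_zero.1 h2
  · rw [trace_sub]
    have e : (pt ρ).trace = ρ.trace := by simp [trace, pt]
    rw [e]
    conv_lhs => enter [1]; rw [h.r0]
    simp [trace, mul_apply, cc, pt, Fintype.sum_prod_type, Fin.sum_univ_three, h.z1, h.z2, h.z3, h.z4]
    ring

lemma r1' (i j k l) : ρ (i,l) (k,j) = ∑ x : Fin 2, ρ (i,x.succ) (0, j) * ρ (0, l) (k, x.succ) +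
    ∑ x : Fin 2, ρ (i,0) (x.succ, j) * ρ (x.succ, l) (k, 0) := by
  have : ρ (i,l) (k,j) = pt ρ (i,j) (k,l) := rfl
  rw [this, h.r1]
  simp [mul_apply, cc, pt]

end NF

/-- the extension property -/
def Phi (ρ : M9) : Prop := ∀ χ : Matrix (Fin 3 × Fin 3) (Fin 3) ℂ,
  (∀ z, ρ *ᵥ z = 0 → star z ᵥ* χ = 0) →
  (∀ z, pt ρ *ᵥ z = 0 → star z ᵥ* (of fun (p : Fin 3 × Fin 3) (l : Fin 3) => χ (p.1, l) p.2) = 0) →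
  ∃ φ : Fin 3 → ℂ, ∀ p l, χ p l = ∑ k, φ k * ρ p (k, l)

lemma factor_c {n m l : Type} [Fintype n] [DecidableEq n] [Fintype m] [DecidableEq m] [Fintype l] [DecidableEq l]
    {M : Matrix n n ℂ} {c : m → n} (hM : M.IsHermitian)
    (h : M = M.submatrix id c * M.submatrix c id) {χ : Matrix n l ℂ}
    (hz : ∀ z, M *ᵥ z = 0 → star z ᵥ* χ = 0) (p j) : χ p j = ∑ x, M p (c x) * χ (c x) j := by
  have h1 := hz (Pi.single p 1 - ∑ x, M (c x) p • Pi.single (c x) 1) (by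
    ext q
    have := congrFun (congrFun h q) p
    simp [mulVec_sub, mulVec_sum, mulVec_smul, mul_apply] at this ⊢
    rw [this, sub_eq_zero]
    exact Finset.sum_congr rfl fun x _ => by ring)
  have h2 := congrFun h1 j
  rw [star_sub, star_sum, sub_vecMul, sum_vecMul] at h2
  simp [star_smul, smul_vecMul] at h2
  rw [sub_eq_zero.1 h2]
  exact Finset.sum_congr rfl fun x _ => by rw [← hM.apply p]; rfl

namespace NF
variable {ρ : M9} (h : NF ρ)
include h

/-- the two linear relations -/
lemma chi {χ : Matrix (Fin 3 × Fin 3) (Fin 3) ℂ}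
    (h1 : ∀ z, ρ *ᵥ z = 0 → star z ᵥ* χ = 0)
    (h2 : ∀ z, pt ρ *ᵥ z = 0 → star z ᵥ* (of fun (p : Fin 3 × Fin 3) (l : Fin 3) => χ (p.1, l) p.2) = 0) :
    (∀ i j l, χ (i,j) l = ∑ x : Fin 2, ρ (i,j) (0, x.succ) * χ (0, x.succ) l +
      ∑ x : Fin 2, ρ (i,j) (x.succ, 0) * χ (x.succ, 0) l) ∧
    (∀ i j l, χ (i,l) j = ∑ x : Fin 2, ρ (i,x.succ) (0, j) * χ (0, l) x.succ +
      ∑ x : Fin 2, ρ (i,0) (x.succ, j) * χ (x.succ, l) 0) := by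
  refine ⟨fun i j l => ?_, fun i j l => ?_⟩
  · have := factor_c h.ppt.1.1 h.r0 h1 (i,j) l
    simpa [cc] using this
  · have := factor_c h.ppt.2.1 h.r1 h2 (i,j) l
    simpa [cc, pt] using this

lemma chi_D {χ : Matrix (Fin 3 × Fin 3) (Fin 3) ℂ}
    (h1 : ∀ i j l, χ (i,j) l = ∑ x : Fin 2, ρ (i,j) (0, x.succ) * χ (0, x.succ) l +
      ∑ x : Fin 2, ρ (i,j) (x.succ, 0) * χ (x.succ, 0) l)
    (h2 : ∀ i j l, χ (i,l) j = ∑ x : Fin 2, ρ (i,x.succ) (0, j) * χ (0, l) x.succ +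
      ∑ x : Fin 2, ρ (i,0) (x.succ, j) * χ (x.succ, l) 0) :
    ∃ (φ : Fin 2 → ℂ) (D : Matrix (Fin 2) (Fin 2) ℂ),
      (∀ p, χ p 0 = ∑ k : Fin 2, φ k * ρ p (k.succ, 0)) ∧
      (∀ p (l : Fin 2), χ p l.succ = ∑ x : Fin 2, ρ p (0, x.succ) * D x l +
        ∑ k : Fin 2, φ k * ρ p (k.succ, l.succ)) ∧
      (∀ i (j l : Fin 2), ∑ x : Fin 2, ρ (i,j.succ) (0, x.succ) * D x l =
        ∑ x : Fin 2, D j x * ρ (i, x.succ) (0, l.succ)) := by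
  set φ : Fin 2 → ℂ := fun k => χ (k.succ, 0) 0 with hφ
  set ω : Matrix (Fin 3 × Fin 3) (Fin 3) ℂ := of fun p l => χ p l - ∑ k : Fin 2, φ k * ρ p (k.succ, l) with hω
  have o1 : ∀ i j l, ω (i,j) l = ∑ x : Fin 2, ρ (i,j) (0, x.succ) * ω (0, x.succ) l +
      ∑ x : Fin 2, ρ (i,j) (x.succ, 0) * ω (x.succ, 0) l := by
    intro i j l
    have a := h1 i j l
    have b := fun k : Fin 2 => h.r0' (i,j) (k.succ, l)
    have b0 := b 0
    have b1 := b 1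
    simp only [hω, of_apply, Fin.sum_univ_two] at a b0 b1 ⊢
    linear_combination a - φ 0 * b0 - φ 1 * b1
  have o2 : ∀ i j l, ω (i,l) j = ∑ x : Fin 2, ρ (i,x.succ) (0, j) * ω (0, l) x.succ +
      ∑ x : Fin 2, ρ (i,0) (x.succ, j) * ω (x.succ, l) 0 := by
    intro i j l
    have a := h2 i j l
    have b := fun k : Fin 2 => h.r1' i j k.succ l
    have b0 := b 0
    have b1 := b 1
    simp only [hω, of_apply, Fin.sum_univ_two] at a b0 b1 ⊢
    linear_combination a - φ 0 * b0 - φ 1 * b1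
  have oz : ∀ k : Fin 2, ω (k.succ, 0) 0 = 0 := by
    intro k
    simp only [hω, of_apply, h.hA]
    simp only [mul_ite, mul_one, mul_zero, Finset.sum_ite_eq, Finset.mem_univ, if_true, hφ, sub_self]
  have oz2 : ∀ l, ω (0,l) 0 = 0 := by
    intro l
    rw [o2]; simp [h.z1, h.z2]
  have oz3 : ∀ p, ω p 0 = 0 := by
    rintro ⟨i, j⟩
    rw [o1]; simp [oz, oz2]
  have oz4 : ∀ l, ω (0,0) l = 0 := by
    intro l; rw [o1]; simp [h.z2]
  have oz5 : ∀ i j, ω (i,0) j = 0 := by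
    intro i j; rw [o2]; simp [oz4, oz3]
  let D : Matrix (Fin 2) (Fin 2) ℂ := of fun x l => ω (0, x.succ) l.succ
  have q1 : ∀ i j (l : Fin 2), ω (i,j) l.succ = ∑ x : Fin 2, ρ (i,j) (0, x.succ) * D x l := by
    intro i j l; rw [o1]; simp [oz5, D]
  have q2 : ∀ i j (l : Fin 2), ω (i,j.succ) l.succ = ∑ x : Fin 2, D j x * ρ (i, x.succ) (0, l.succ) := by
    intro i j l; rw [o2]; simp [oz3, D, mul_comm]
  refine ⟨φ, D, fun p => ?_, fun p l => ?_, fun i j l => ?_⟩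
  · have := oz3 p
    simp only [hω, of_apply] at this
    exact sub_eq_zero.1 this
  · rw [← q1]; simp [hω]
  · rw [← q1, q2]

lemma finish_scalar {χ : Matrix (Fin 3 × Fin 3) (Fin 3) ℂ} {φ : Fin 2 → ℂ} {c : ℂ}
    (h1 : ∀ p, χ p 0 = ∑ k : Fin 2, φ k * ρ p (k.succ, 0))
    (h2 : ∀ p (l : Fin 2), χ p l.succ = ∑ x : Fin 2, ρ p (0, x.succ) * (c • (1 : Matrix (Fin 2) (Fin 2) ℂ)) x l +
        ∑ k : Fin 2, φ k * ρ p (k.succ, l.succ)) :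
    ∃ φ : Fin 3 → ℂ, ∀ p l, χ p l = ∑ k, φ k * ρ p (k, l) := by
  refine ⟨Fin.cons c φ, fun p l => ?_⟩
  rw [Fin.sum_univ_succ]
  simp only [Fin.cons_zero, Fin.cons_succ]
  cases l using Fin.cases with
  | zero => rw [h1, h.z1]; simp
  | succ l => 
    rw [h2]
    simp [one_apply, mul_comm]

end NF

/-- centralizer of nonscalar 2x2 -/
lemma central2 {D A : Matrix (Fin 2) (Fin 2) ℂ} (hD : ∀ c : ℂ, D ≠ c • 1) (h : A * D = D * A) :
    ∃ p q : ℂ, A = p • D + q • 1 := by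
  have e : ∀ i j, (A * D) i j = (D * A) i j := fun i j => by rw [h]
  have e00 := e 0 0
  have e01 := e 0 1
  have e10 := e 1 0
  simp [mul_apply, Fin.sum_univ_two] at e00 e01 e10
  by_cases h01 : D 0 1 = 0
  · by_cases h10 : D 1 0 = 0
    · have hne : D 0 0 - D 1 1 ≠ 0 := fun hh => hD (D 0 0) (by
        ext i j; fin_cases i <;> fin_cases j <;> simp [h01, h10]
        linear_combination -hh)
      rw [h01] at e01
      rw [h10] at e10
      have a01 : A 0 1 = 0 := by
        apply (mul_eq_zero.1 (_ : (D 0 0 - D 1 1) * A 0 1 = 0)).resolve_left hne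
        linear_combination -e01
      have a10 : A 1 0 = 0 := by
        apply (mul_eq_zero.1 (_ : (D 0 0 - D 1 1) * A 1 0 = 0)).resolve_left hne
        linear_combination e10
      refine ⟨(A 0 0 - A 1 1) / (D 0 0 - D 1 1), A 0 0 - (A 0 0 - A 1 1) / (D 0 0 - D 1 1) * D 0 0, ?_⟩
      ext i j; fin_cases i <;> fin_cases j <;> simp [h01, h10, a01, a10]
      field_simp; ring
    · refine ⟨A 1 0 / D 1 0, A 0 0 - A 1 0 / D 1 0 * D 0 0, ?_⟩
      ext i j; fin_cases i <;> fin_cases j <;> simp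
      · field_simp; linear_combination e00
      · field_simp
      · field_simp; linear_combination e10
  · refine ⟨A 0 1 / D 0 1, A 0 0 - A 0 1 / D 0 1 * D 0 0, ?_⟩
    ext i j; fin_cases i <;> fin_cases j <;> simp
    · field_simp
    · field_simp; linear_combination -e00
    · field_simp; linear_combination -e01


def nP (ρ : M9) (i : Fin 3) : Matrix (Fin 2) (Fin 2) ℂ := of fun x j => ρ (0,x.succ) (i,j.succ)
def nT (ρ : M9) (l : Fin 3) : Matrix (Fin 2) (Fin 2) ℂ := of fun x k => ρ (x.succ,0) (k.succ,l)

lemma sep_of_fam {T : Fin 3 → Matrix (Fin 2) (Fin 2) ℂ} (hT : ∀ i j, (T i)ᴴ * T j = T j * (T i)ᴴ)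
    {V : M9} (h0 : ∀ j q, V (0,j) q = 0) (h0' : ∀ j q, V q (0,j) = 0)
    (h1 : ∀ (i k : Fin 2) j l, V (i.succ,j) (k.succ,l) = ((T j)ᴴ * T l) i k) : Sepa V := by
  let V' : Matrix (Fin 2 × Fin 3) (Fin 2 × Fin 3) ℂ := of fun p q => ((T p.2)ᴴ * T q.2) p.1 q.1
  have hV' : Sepa V' := sep_normal T hT id (fun i j k l => rfl)
  have : V = ltr (pQ 2) (1 : Matrix (Fin 3) (Fin 3) ℂ) V' := by
    ext ⟨i, j⟩ ⟨k, l⟩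
    rw [blk_apply' (ltr (pQ 2) (1 : Matrix (Fin 3) (Fin 3) ℂ) V'), blk_ltr]
    obtain ⟨q1, q2, q3⟩ := pQ_conj (blk V' j l)
    cases i using Fin.cases with
    | zero => rw [q1, h0]
    | succ i =>
      cases k using Fin.cases with
      | zero => rw [q2, h0']
      | succ k => rw [q3, h1]; rfl
  rw [this]
  exact hV'.ltr _ _

namespace NF
variable {ρ : M9} (h : NF ρ)
include h

lemma nP0 : nP ρ 0 = 1 := by
  ext i j; simp only [nP, of_apply, h.hB, one_apply]

lemma nT0 : nT ρ 0 = 1 := by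
  ext i j; simp only [nT, of_apply, h.hA, one_apply]

lemma st (p q) : ρ p q = star (ρ q p) := (h.ppt.1.1.apply _ _).symm

lemma rel (i k j l : Fin 2) :
    ((nP ρ i.succ)ᴴ * nP ρ k.succ) l j + ((nT ρ l.succ)ᴴ * nT ρ j.succ) i k =
    (nP ρ k.succ * (nP ρ i.succ)ᴴ) l j + (nT ρ j.succ * (nT ρ l.succ)ᴴ) i k := by
  have e1 := h.r0' (i.succ, l.succ) (k.succ, j.succ)
  have e2 := h.r1' i.succ j.succ k.succ l.succ
  have e3 := e1.symm.trans e2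
  simp only [mul_apply, nP, nT, of_apply, conjTranspose_apply, ← h.st]
  rw [e3]
  congr 1
  exact Finset.sum_congr rfl fun x _ => by ring

lemma sep_of_normal (hP : ∀ i j : Fin 2, (nP ρ i.succ)ᴴ * nP ρ j.succ = nP ρ j.succ * (nP ρ i.succ)ᴴ) :
    Sepa ρ := by
  have hT : ∀ i j : Fin 2, (nT ρ i.succ)ᴴ * nT ρ j.succ = nT ρ j.succ * (nT ρ i.succ)ᴴ := by
    intro l j
    ext i k
    have := h.rel i k j l
    rw [hP] at this
    exact add_left_cancel this
  have hP' : ∀ i j, (nP ρ i)ᴴ * nP ρ j = nP ρ j * (nP ρ i)ᴴ := by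
    intro i j
    cases i using Fin.cases with
    | zero => simp [h.nP0]
    | succ i =>
      cases j using Fin.cases with
      | zero => simp [h.nP0]
      | succ j => exact hP i j
  have hT' : ∀ i j, (nT ρ i)ᴴ * nT ρ j = nT ρ j * (nT ρ i)ᴴ := by
    intro i j
    cases i using Fin.cases with
    | zero => simp [h.nT0]
    | succ i =>
      cases j using Fin.cases with
      | zero => simp [h.nT0]
      | succ j => exact hT i j
  let U : M9 := of fun p q => ∑ x : Fin 2, ρ p (0, x.succ) * ρ (0, x.succ) q
  let V : M9 := of fun p q => ∑ x : Fin 2, ρ p (x.succ, 0) * ρ (x.succ, 0) q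
  have hUV : ρ = U + V := by
    ext p q; exact h.r0' p q
  have hU : Sepa (sw U) := by
    refine sep_of_fam hP' ?_ ?_ ?_
    · intro j q; simp [sw, U, h.z3]
    · intro j q; simp [sw, U, h.z4]
    · intro i k j l
      simp only [sw, U, submatrix_apply, of_apply, Prod.swap, mul_apply, conjTranspose_apply, nP, ← h.st]
  have hV : Sepa V := by
    refine sep_of_fam hT' ?_ ?_ ?_
    · intro j q; simp [V, h.z4]
    · intro j q; simp [V, h.z3]
    · intro i k j l
      simp only [V, of_apply, mul_apply, conjTranspose_apply, nT, ← h.st]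
  rw [hUV]
  exact (sep_of_sw hU).add hV

lemma sum_comm0 : ∑ i : Fin 2, ((nP ρ i.succ)ᴴ * nP ρ i.succ - nP ρ i.succ * (nP ρ i.succ)ᴴ) = 0 := by
  ext l j
  have e0 := h.rel 0 0 j l
  have e1 := h.rel 1 1 j l
  have t := trace_mul_comm (nT ρ j.succ) (nT ρ l.succ)ᴴ
  simp only [trace, diag, Fin.sum_univ_two] at t
  simp only [Fin.sum_univ_two, Matrix.add_apply, Matrix.sub_apply, Matrix.zero_apply]
  linear_combination e0 + e1 + t

lemma core (hns : ¬ Sepa ρ) : Phi ρ := by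
  intro χ h1 h2
  obtain ⟨g1, g2⟩ := h.chi h1 h2
  obtain ⟨φ, D, d1, d2, d3⟩ := h.chi_D g1 g2
  by_cases hD : ∃ c : ℂ, D = c • 1
  · obtain ⟨c, rfl⟩ := hD
    exact h.finish_scalar d1 d2
  exfalso
  push Not at hD
  have hc : ∀ i : Fin 2, ∃ p q : ℂ, (nP ρ i.succ)ᴴ = p • D + q • 1 := by
    intro i
    refine central2 hD ?_
    ext j l
    simp only [mul_apply, conjTranspose_apply, nP, of_apply, ← h.st]
    exact d3 i.succ j l
  choose p q hpq using hc
  have hpq' : ∀ i, nP ρ i.succ = star (p i) • Dᴴ + star (q i) • 1 := fun i => by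
    rw [← conjTranspose_conjTranspose (nP ρ i.succ), hpq]; simp
  have hcomm : ∀ i k, (nP ρ i.succ)ᴴ * nP ρ k.succ - nP ρ k.succ * (nP ρ i.succ)ᴴ =
      (p i * star (p k)) • (D * Dᴴ - Dᴴ * D) := by
    intro i k
    rw [hpq, hpq']
    simp only [Matrix.add_mul, Matrix.mul_add, Matrix.smul_mul, Matrix.mul_smul, Matrix.mul_one, Matrix.one_mul, smul_sub]
    module
  have hs := h.sum_comm0
  simp only [hcomm] at hs
  rw [← Finset.sum_smul] at hs
  apply hns
  apply h.sep_of_normal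
  intro i k
  rw [← sub_eq_zero, hcomm]
  rcases smul_eq_zero.1 hs with hs | hs
  · have hp : p i = 0 := by
      have hs' : star (star p) ⬝ᵥ star p = 0 := by
        simpa [dotProduct] using hs
      have := dotProduct_star_self_eq_zero.1 hs'
      simpa using congrFun this i
    rw [hp]; simp
  · rw [hs, smul_zero]

end NF


def ext2 (U : Matrix (Fin 2) (Fin 2) ℂ) : Matrix (Fin 3) (Fin 3) ℂ :=
  of fun i j => Fin.cases (Fin.cases 1 (fun _ => 0) j) (fun i' => Fin.cases 0 (fun j' => U i' j') j) i

lemma ext2_00 (U) : ext2 U 0 0 = 1 := rfl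
lemma ext2_0s (U) (j : Fin 2) : ext2 U 0 j.succ = 0 := rfl
lemma ext2_s0 (U) (j : Fin 2) : ext2 U j.succ 0 = 0 := rfl
lemma ext2_ss (U) (i j : Fin 2) : ext2 U i.succ j.succ = U i j := rfl

lemma ext2_mul (U V) : ext2 U * ext2 V = ext2 (U * V) := by
  ext i j
  cases i using Fin.cases <;> cases j using Fin.cases <;>
  simp only [mul_apply, Fin.sum_univ_succ (n := 2), ext2_00, ext2_0s, ext2_s0, ext2_ss, mul_zero, zero_mul,
    Finset.sum_const_zero, add_zero, zero_add, mul_one]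

lemma ext2_one : ext2 1 = 1 := by
  ext i j
  cases i using Fin.cases <;> cases j using Fin.cases <;>
  simp [ext2_00, ext2_0s, ext2_s0, ext2_ss, one_apply, (Fin.succ_ne_zero _).symm]

lemma ext2_unit {U} (h : IsUnit U) : IsUnit (ext2 U) := by
  refine IsUnit.of_mul_eq_one (ext2 U⁻¹) ?_
  rw [ext2_mul, mul_nonsing_inv _ ((isUnit_iff_isUnit_det _).1 h), ext2_one]

lemma ext2_col (U) (i) : ext2 U i 0 = if i = 0 then 1 else 0 := by
  cases i using Fin.cases <;> simp [ext2_00, ext2_s0]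

lemma ext2_conj (U) (X : Matrix (Fin 3) (Fin 3) ℂ) :
    ((ext2 U)ᴴ * X * ext2 U) 0 0 = X 0 0 ∧
    ∀ j l : Fin 2, ((ext2 U)ᴴ * X * ext2 U) j.succ l.succ =
      (Uᴴ * (of fun j l : Fin 2 => X j.succ l.succ) * U) j l := by
  refine ⟨?_, fun j l => ?_⟩
  · simp [mul_apply, Fin.sum_univ_succ (n := 2), ext2_00, ext2_s0]
  · simp only [mul_apply, Fin.sum_univ_succ (n := 2), ext2_0s, ext2_ss, conjTranspose_apply, of_apply, mul_zero, zero_mul,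
    star_zero, zero_add]

/-- first row block -/
def rB (ρ : M9) : Matrix (Fin 3) (Fin 3) ℂ := of fun j l => ρ (0,j) (0,l)

lemma rB_ltr {S T} (hS : ∀ i : Fin 3, S i 0 = if i = 0 then (1:ℂ) else 0) (ρ : M9) :
    rB (ltr S T ρ) = Tᴴ * rB ρ * T := by
  ext j l
  simp [rB, ltr, mul_apply, Fintype.sum_prod_type, hS, apply_ite (starRingEnd ℂ)]

lemma sw_ltr (S T : Matrix (Fin 3) (Fin 3) ℂ) (ρ : M9) : sw (ltr S T ρ) = ltr T S (sw ρ) := by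
  ext p q
  simp only [sw, submatrix_apply, ltr_apply]
  let e : (Fin 3 × Fin 3) × (Fin 3 × Fin 3) ≃ (Fin 3 × Fin 3) × (Fin 3 × Fin 3) :=
    Equiv.prodCongr (Equiv.prodComm _ _) (Equiv.prodComm _ _)
  refine Fintype.sum_equiv e _ _ fun x => ?_
  simp [e]
  ring

def KB (ρ : M9) : Matrix (Fin 2) (Fin 2) ℂ := of fun j l => ρ (0,j.succ) (0,l.succ)

lemma KB_ltr (V U) (ρ : M9) : ltr (ext2 V) (ext2 U) ρ (0,0) (0,0) = ρ (0,0) (0,0) ∧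
    KB (ltr (ext2 V) (ext2 U) ρ) = Uᴴ * KB ρ * U := by
  have e := rB_ltr (T := ext2 U) (ext2_col V) ρ
  obtain ⟨e1, e2⟩ := ext2_conj U (rB ρ)
  rw [← e] at e1 e2
  refine ⟨e1, ?_⟩
  ext j l
  exact e2 j l

lemma sw_rank (ρ : M9) : (sw ρ).rank ≤ ρ.rank := rank_submatrix_le _ _ _

lemma KB_posDef {ρ : M9} (h : PPT ρ) (hr : ρ.rank ≤ 4) (hz : ρ (0,0) (0,0) = 0) (hns : ¬ Sepa ρ) :
    (KB ρ).PosDef := by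
  have hps : (KB ρ).PosSemidef := h.1.submatrix (fun j : Fin 2 => ((0 : Fin 3), j.succ))
  refine posDef_of hps fun u hu => ?_
  by_contra hne
  obtain ⟨U, hU, hU0⟩ := exists_col hne
  apply hns
  apply sep_of_ltr (ext2_unit (isUnit_one)) (ext2_unit hU)
  set ρ2 := ltr (ext2 1) (ext2 U) ρ with hρ2
  obtain ⟨e1, e2⟩ := KB_ltr 1 U ρ
  have h2 : PPT ρ2 := h.ltr _ _
  have e3 : ρ2 (0,1) (0,1) = 0 := by
    have : ρ2 (0,1) (0,1) = KB ρ2 0 0 := rfl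
    rw [this, hρ2, e2]
    have h5 : (Uᴴ * KB ρ * U) *ᵥ Pi.single 0 1 = 0 := by
      rw [← mulVec_mulVec, hU0, ← mulVec_mulVec, hu, mulVec_zero]
    simpa using congrFun h5 0
  obtain ⟨R, hR⟩ := peel h2 2 (fun j hj => by
    fin_cases j
    · exact e1.trans hz
    · exact e3
    · exact absurd rfl hj)
  apply hR
  apply sep_of_sw
  refine woron3 _ _ (h2.ltr _ _).sw ?_ rfl
  refine (rank_submatrix_le _ _ _).trans ((rank_ltr_le _ _ _).trans ((rank_ltr_le _ _ _).trans hr))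

lemma norm_main {ρ : M9} (h : PPT ρ) (hr : ρ.rank = 4) (hns : ¬ Sepa ρ) :
    ∃ S T, IsUnit S ∧ IsUnit T ∧ NF (ltr S T ρ) := by
  obtain ⟨F, hF⟩ := gram h.1 hr.le
  obtain ⟨v, w, hv, hw, hz⟩ := prod_ker F
  obtain ⟨S, hS, rfl⟩ := exists_col hv
  obtain ⟨T, hT, rfl⟩ := exists_col hw
  have hz1 : ltr S T ρ (0,0) (0,0) = 0 := ltr_ker (by rw [hF, ← mulVec_mulVec, hz, mulVec_zero])
  set ρ1 := ltr S T ρ with hρ1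
  have p1 : PPT ρ1 := h.ltr _ _
  have r1 : ρ1.rank ≤ 4 := (rank_ltr_le _ _ _).trans hr.le
  have n1 : ¬ Sepa ρ1 := fun hh => hns (sep_of_ltr hS hT hh)
  obtain ⟨U, hU, hU1⟩ := norm_one (KB_posDef p1 r1 hz1 n1)
  obtain ⟨V, hV, hV1⟩ := norm_one (KB_posDef (ρ := sw ρ1) p1.sw ((sw_rank _).trans r1) hz1
    (fun hh => n1 (sep_of_sw hh)))
  refine ⟨S * ext2 V, T * ext2 U, hS.mul (ext2_unit hV), hT.mul (ext2_unit hU), ?_⟩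
  rw [← ltr_ltr, ← hρ1]
  obtain ⟨a1, a2⟩ := KB_ltr V U ρ1
  obtain ⟨b1, b2⟩ := KB_ltr U V (sw ρ1)
  rw [hU1] at a2
  rw [hV1, ← sw_ltr] at b2
  refine ⟨p1.ltr _ _, (rank_ltr_le _ _ _).trans r1, a1.trans hz1, fun j l => ?_, fun j l => ?_⟩
  · have := congrFun (congrFun a2 j) l
    rwa [one_apply] at this
  · have := congrFun (congrFun b2 j) l
    rwa [one_apply] at this

def colm (φ : Fin 3 → ℂ) : Matrix (Fin 3 × Fin 3) (Fin 3) ℂ := of fun p l => φ p.1 * if p.2 = l then 1 else 0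

lemma mul_colm (M : M9) (φ : Fin 3 → ℂ) (p l) : (M * colm φ) p l = ∑ k, φ k * M p (k,l) := by
  simp [mul_apply, colm, Fintype.sum_prod_type, mul_comm]

lemma kron_colm (S T : Matrix (Fin 3) (Fin 3) ℂ) (φ : Fin 3 → ℂ) :
    (S ⊗ₖ T) * colm φ = colm (S *ᵥ φ) * T := by
  ext p l
  rw [mul_colm]
  simp [mul_apply, colm, mulVec, dotProduct, Finset.sum_mul]
  exact Finset.sum_congr rfl fun k _ => by ring

def gam (χ : Matrix (Fin 3 × Fin 3) (Fin 3) ℂ) : Matrix (Fin 3 × Fin 3) (Fin 3) ℂ :=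
  of fun p l => χ (p.1, l) p.2

lemma gam_tr (S T : Matrix (Fin 3) (Fin 3) ℂ) (χ) : gam ((S ⊗ₖ T)ᴴ * χ * T) =
    (S ⊗ₖ T.map star)ᴴ * gam χ * T.map star := by
  ext p l
  simp only [gam, mul_apply, of_apply, Finset.sum_mul, conjTranspose_apply, kroneckerMap_apply,
    Fintype.sum_prod_type, map_apply, star_mul', star_star]
  rw [Finset.sum_comm]
  conv_rhs => rw [Finset.sum_comm]
  refine Finset.sum_congr rfl fun i _ => ?_
  rw [Finset.sum_comm]
  refine Finset.sum_congr rfl fun j _ => Finset.sum_congr rfl fun k _ => ?_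
  ring

lemma Phi_of_ltr {ρ : M9} {S T : Matrix (Fin 3) (Fin 3) ℂ} (hS : IsUnit S) (hT : IsUnit T)
    (h : Phi (ltr S T ρ)) : Phi ρ := by
  have aux : ∀ {T : Matrix (Fin 3) (Fin 3) ℂ}, IsUnit T → ∀ {ρ : M9} {χ : Matrix (Fin 3 × Fin 3) (Fin 3) ℂ}, 
      (∀ z, ρ *ᵥ z = 0 → star z ᵥ* χ = 0) → 
      ∀ z, ltr S T ρ *ᵥ z = 0 → star z ᵥ* ((S ⊗ₖ T)ᴴ * χ * T) = 0 := by
    intro T hT ρ χ h1 z hz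
    have hK : (S⁻¹ ⊗ₖ T⁻¹)ᴴ * (S ⊗ₖ T)ᴴ = 1 := by
      rw [← conjTranspose_mul, ← mul_kronecker_mul, mul_nonsing_inv _ ((isUnit_iff_isUnit_det _).1 hS),
        mul_nonsing_inv _ ((isUnit_iff_isUnit_det _).1 hT), one_kronecker_one, conjTranspose_one]
    have h2 : ρ *ᵥ ((S ⊗ₖ T) *ᵥ z) = 0 := by
      have h3 := congrArg (fun x => (S⁻¹ ⊗ₖ T⁻¹)ᴴ *ᵥ x) hz
      simp only [mulVec_zero] at h3
      rwa [ltr, mulVec_mulVec, ← Matrix.mul_assoc, ← Matrix.mul_assoc, hK, Matrix.one_mul, ← mulVec_mulVec] at h3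
    have h3 := h1 _ h2
    rw [star_mulVec] at h3
    rw [← vecMul_vecMul, ← vecMul_vecMul, h3, zero_vecMul]
  intro χ h1 h2
  have hT' : IsUnit (T.map star) := by
    refine IsUnit.of_mul_eq_one (T⁻¹.map star) ?_
    have := congrArg (fun X => X.map (starRingEnd ℂ)) (mul_nonsing_inv _ ((isUnit_iff_isUnit_det _).1 hT))
    simp only [Matrix.map_mul] at this
    refine this.trans ?_
    simp
  obtain ⟨φ, hφ⟩ := h ((S ⊗ₖ T)ᴴ * χ * T) (aux hT h1) (fun z hz => by
    change star z ᵥ* gam _ = 0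
    rw [gam_tr]
    rw [pt_ltr] at hz
    exact aux hT' h2 z hz)
  refine ⟨S *ᵥ φ, fun p l => ?_⟩
  have e1 : (S ⊗ₖ T)ᴴ * χ * T = ltr S T ρ * colm φ := by
    ext p l; rw [mul_colm, hφ]
  rw [ltr, Matrix.mul_assoc _ _ (colm φ), kron_colm, ← Matrix.mul_assoc] at e1
  have hK : (S⁻¹ ⊗ₖ T⁻¹)ᴴ * (S ⊗ₖ T)ᴴ = 1 := by
    rw [← conjTranspose_mul, ← mul_kronecker_mul, mul_nonsing_inv _ ((isUnit_iff_isUnit_det _).1 hS),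
      mul_nonsing_inv _ ((isUnit_iff_isUnit_det _).1 hT), one_kronecker_one, conjTranspose_one]
  have hTT := mul_nonsing_inv _ ((isUnit_iff_isUnit_det _).1 hT)
  have e2 : (S⁻¹ ⊗ₖ T⁻¹)ᴴ * ((S ⊗ₖ T)ᴴ * (χ * (T * T⁻¹))) =
      (S⁻¹ ⊗ₖ T⁻¹)ᴴ * ((S ⊗ₖ T)ᴴ * (ρ * (colm (S *ᵥ φ) * (T * T⁻¹)))) := by
    have := congrArg (fun X => (S⁻¹ ⊗ₖ T⁻¹)ᴴ * X * T⁻¹) e1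
    simpa only [Matrix.mul_assoc] using this
  rw [hTT, Matrix.mul_one, Matrix.mul_one, ← Matrix.mul_assoc, ← Matrix.mul_assoc, hK,
    Matrix.one_mul, Matrix.one_mul] at e2
  rw [e2, mul_colm]


lemma ext_ker {M : Matrix (Fin 4 × Fin 3) (Fin 4 × Fin 3) ℂ} (h : M.PosSemidef) {N : M9}
    (hN : ∀ p q : Fin 3 × Fin 3, M (p.1.castSucc, p.2) (q.1.castSucc, q.2) = N p q)
    (z : Fin 3 × Fin 3 → ℂ) (hz : N *ᵥ z = 0) :
    star z ᵥ* (of fun (p : Fin 3 × Fin 3) (l : Fin 3) => M (p.1.castSucc, p.2) ((3 : Fin 4), l)) = 0 := by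
  let w : Fin 4 × Fin 3 → ℂ := fun p => Fin.lastCases (motive := fun _ => ℂ) 0 (fun i => z (i, p.2)) p.1
  have w1 : ∀ (i : Fin 3) j, w (i.castSucc, j) = z (i, j) := fun i j => by simp [w]
  have w2 : ∀ j, w (3, j) = 0 := fun j => Fin.lastCases_last (motive := fun _ => ℂ)
  have key : ∀ a, (M *ᵥ w) a = ∑ q : Fin 3 × Fin 3, M a (q.1.castSucc, q.2) * z q := fun a => by
    simp only [mulVec, dotProduct, Fintype.sum_prod_type]
    rw [Fin.sum_univ_castSucc]
    simp [w1, w2]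
  have k1 : ∀ p : Fin 3 × Fin 3, (M *ᵥ w) (p.1.castSucc, p.2) = 0 := fun p => by
    rw [key]
    simp only [hN]
    exact congrFun hz p
  have k2 : M *ᵥ w = 0 := by
    apply psd_ker h
    simp only [dotProduct, Fintype.sum_prod_type]
    rw [Fin.sum_univ_castSucc]
    have : ∀ (i : Fin 3) j, (M *ᵥ w) (i.castSucc, j) = 0 := fun i j => k1 (i, j)
    simp [this, w2]
  ext l
  have k3 := congrArg star (congrFun k2 (3, l))
  rw [key] at k3
  simp only [star_sum, star_mul', h.1.apply, Pi.zero_apply, star_zero] at k3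
  simp only [vecMul, dotProduct, of_apply, Pi.star_apply, Pi.zero_apply]
  rw [← k3]
  exact Finset.sum_congr rfl fun p _ => mul_comm _ _

theorem rank4_3x3_ppt_entangled_unextendible
    (ρc : Matrix (Fin 3 × Fin 3) (Fin 3 × Fin 3) ℂ) (hρc : ρc.PosSemidef)
    (hppt : (ptB ρc).PosSemidef) (hrank : ρc.rank = 4) (hent : ¬ SNle ρc 1) :
    ∀ ρ : Matrix (Fin 4 × Fin 3) (Fin 4 × Fin 3) ℂ,
      ρ.PosSemidef → (ptB ρ).PosSemidef →
      (∀ p q : Fin 3 × Fin 3, ρ (p.1.castSucc, p.2) (q.1.castSucc, q.2) = ρc p q) →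
      ∃ φ : Fin 3 → ℂ, ∀ y : Fin 3 → ℂ,
        (Matrix.of fun (p : Fin 3 × Fin 3) (l : Fin 3) =>
            ρ (p.1.castSucc, p.2) ((3 : Fin 4), l)).mulVec y
          = ρc.mulVec (fun p => φ p.1 * y p.2) := by
  intro ρ h1 h2 hc
  have hns : ¬ Sepa ρc := fun h => hent (SNle_of_sep h)
  have hP : PPT ρc := ⟨hρc, hppt⟩
  obtain ⟨S, T, hS, hT, hNF⟩ := norm_main hP hrank hns
  have hPhi : Phi ρc := Phi_of_ltr hS hT (hNF.core fun h => hns (sep_of_ltr hS hT h))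
  obtain ⟨φ, hφ⟩ := hPhi (of fun (p : Fin 3 × Fin 3) (l : Fin 3) =>
    ρ (p.1.castSucc, p.2) ((3 : Fin 4), l)) (ext_ker h1 hc)
    (ext_ker (N := pt ρc) h2 fun p q => hc (p.1, q.2) (q.1, p.2))
  refine ⟨φ, fun y => ?_⟩
  ext p
  simp only [mulVec, dotProduct, Fintype.sum_prod_type, hφ]
  rw [Finset.sum_comm]
  refine Finset.sum_congr rfl fun l _ => ?_
  rw [Finset.sum_mul]
  exact Finset.sum_congr rfl fun k _ => by ring
end

section
/- For all complex numbers ψ00, ψ01, ψ02, ψ04, ψ10, ψ20, ψ23, ψ30, ψ32, if the 4×5 complex matrix Ψ = [[ψ00, ψ01, ψ02, 0, ψ04], [ψ10, ψ00, ψ01, 0, 0], [ψ20, −ψ10, ψ00, ψ23, 0], [ψ30, 0, ψ32, ψ20, ψ02]] has rank at most 2, then ψ00 = 0. -/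
open Matrix

lemma aux_minor (A : Matrix (Fin 4) (Fin 5) ℂ) (h : A.rank ≤ 2) (r : Fin 3 → Fin 4)
    (c : Fin 3 → Fin 5) : (A.submatrix r c).det = 0 := by
  by_contra hd
  have h1 : (A.submatrix r c).rank = 3 := by
    rw [Matrix.rank_of_isUnit _ ((Matrix.isUnit_iff_isUnit_det _).2 (isUnit_iff_ne_zero.2 hd))]
    simp
  have h2 := Matrix.rank_submatrix_le A r c
  omega

/-- If the coordinate matrix `Ψ` has rank at most 2, then `ψ00 = 0`. -/
theorem coordinate_matrix_rank_le_two_imp_psi00_eq_zero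
    (ψ00 ψ01 ψ02 ψ04 ψ10 ψ20 ψ23 ψ30 ψ32 : ℂ)
    (h : (!![ψ00, ψ01, ψ02, 0, ψ04;
             ψ10, ψ00, ψ01, 0, 0;
             ψ20, -ψ10, ψ00, ψ23, 0;
             ψ30, 0, ψ32, ψ20, ψ02] : Matrix (Fin 4) (Fin 5) ℂ).rank ≤ 2) :
    ψ00 = 0 := by
  have m := aux_minor _ h
  by_contra hx
  by_cases he : ψ04 = 0
  · subst he
    by_cases hb : ψ02 = 0
    · subst hb
      have a1 := m ![0,1,2] ![0,1,3]
      have a3 := m ![0,1,2] ![1,2,3]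
      have b1 := m ![0,1,3] ![0,1,3]
      have b3 := m ![0,1,3] ![1,2,3]
      have c1 := m ![0,1,2] ![0,1,2]
      simp only [Matrix.det_fin_three, Matrix.submatrix_apply] at a1 a3 b1 b3 c1
      simp at a1 a3 b1 b3 c1
      clear m h
      have hg : ψ23 = 0 := by grind
      have hd : ψ20 = 0 := by grind
      subst hg hd
      have : ψ00 ^ 3 = 0 := by linear_combination c1
      exact hx (by simpa using this)
    · have a1 := m ![0,1,3] ![0,1,4]
      have a2 := m ![1,2,3] ![1,2,4]
      simp only [Matrix.det_fin_three, Matrix.submatrix_apply] at a1 a2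
      simp at a1 a2
      clear m h
      have : ψ02 * ψ00 ^ 2 = 0 := by grind
      simp_all
  · have a1 := m ![0,1,2] ![1,3,4]
    have a2 := m ![0,1,2] ![0,1,4]
    have a3 := m ![0,1,2] ![1,2,4]
    have a4 := m ![0,1,3] ![0,3,4]
    simp only [Matrix.det_fin_three, Matrix.submatrix_apply] at a1 a2 a3 a4
    simp at a1 a2 a3 a4
    clear m h
    grind
end

section
/- Let ρ be a positive semidefinite matrix indexed by Fin m × Fin n over ℂ with Schmidt number exactly k ≥ 1 (SN(ρ) ≤ k and ¬(SN(ρ) ≤ k−1) when k ≥ 2). Then there exist natural numbers m_1 ≤ … ≤ m_k = m and n_1 ≤ … ≤ n_k = n, positive semidefinite matrices ρ^(i) indexed by Fin m_i × Fin n_i with ρ^(k) = ρ and Schmidt number of ρ^(i) exactly i for each i, and for each i < k matrices A_i (size m_i × m_{i+1}) and B_i (size n_i × n_{i+1}) with A_i A_i* = 1_{m_i} and B_i B_i* = 1_{n_i}, such that ρ^(i) = (A_i ⊗ B_i) ρ^(i+1) (A_i ⊗ B_i)* (a projection onto a local block). That is, every Schmidt number k state is the local extension of a Schmidt number (k−1)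 state, down to a separable state. -/
open Matrix Kronecker ComplexOrder

theorem aux_ginv {d : Type*} [Fintype d] [DecidableEq d] (S : Matrix d d ℂ) (hS : S.IsHermitian) :
    ∃ G : Matrix d d ℂ, Gᴴ = G ∧ S * G * S = S := by
  have h := hS.spectral_theorem
  rw [Unitary.conjStarAlgAut_apply] at h
  set U : Matrix d d ℂ := (hS.eigenvectorUnitary : Matrix d d ℂ) with hU
  have hUU : star U * U = 1 := Unitary.coe_star_mul_self hS.eigenvectorUnitary
  set D : d → ℂ := RCLike.ofReal ∘ hS.eigenvalues with hD
  refine ⟨U * diagonal (fun i => (D i)⁻¹) * star U, ?_, ?_⟩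
  · rw [star_eq_conjTranspose, conjTranspose_mul, conjTranspose_mul, conjTranspose_conjTranspose,
      diagonal_conjTranspose, mul_assoc]
    congr 3
    ext i
    simp [hD]
  · have : S = U * diagonal D * star U := h
    rw [this]
    calc U * diagonal D * star U * (U * diagonal (fun i => (D i)⁻¹) * star U) *
          (U * diagonal D * star U)
        = U * (diagonal D * (star U * U) * diagonal (fun i => (D i)⁻¹) * (star U * U) *
          diagonal D) * star U := by simp only [mul_assoc]
      _ = U * diagonal D * star U := by
          rw [hUU, mul_one, mul_one, diagonal_mul_diagonal, diagonal_mul_diagonal]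
          congr 3
          ext i
          by_cases h0 : D i = 0
          · simp [h0]
          · field_simp

theorem aux_cancel {d e : Type*} [Fintype d] [DecidableEq d] [Fintype e]
    (S G : Matrix d d ℂ) (X : Matrix d e ℂ) (hX : X * Xᴴ = S) (h : S * G * S = S) :
    S * G * X = X := by
  have h1 : (S * G - 1) * X * ((S * G - 1) * X)ᴴ = 0 := by
    rw [conjTranspose_mul]
    calc (S * G - 1) * X * (Xᴴ * (S * G - 1)ᴴ)
        = (S * G - 1) * (X * Xᴴ) * (S * G - 1)ᴴ := by simp only [Matrix.mul_assoc]
      _ = 0 := by rw [hX, sub_mul, h, one_mul, sub_self, zero_mul]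
  have h2 := Matrix.self_mul_conjTranspose_eq_zero.mp h1
  rw [Matrix.sub_mul, Matrix.one_mul, sub_eq_zero] at h2
  exact h2

/-- unitary freedom -/
theorem aux_freedom {d e f : Type*} [Fintype d] [DecidableEq d] [Fintype e] [DecidableEq e]
    [Fintype f] (X : Matrix d e ℂ) (W : Matrix d f ℂ) (h : X * Xᴴ = W * Wᴴ) :
    ∃ (V : Matrix e f ℂ) (Q : Matrix e e ℂ), X * V = W ∧ X * Q = 0 ∧ V * Vᴴ + Q * Qᴴ = 1 := by
  obtain ⟨G, hG, hS⟩ := aux_ginv (X * Xᴴ) (isHermitian_mul_conjTranspose_self X)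
  have hx := aux_cancel _ G X rfl hS
  have hw := aux_cancel _ G W h.symm hS
  have hxP : X * (Xᴴ * G * X) = X := by
    rw [← Matrix.mul_assoc, ← Matrix.mul_assoc, hx]
  have hP : (Xᴴ * G * X)ᴴ = Xᴴ * G * X := by
    simp only [conjTranspose_mul, conjTranspose_conjTranspose, hG, Matrix.mul_assoc]
  have hPP : (Xᴴ * G * X) * (Xᴴ * G * X) = Xᴴ * G * X := by
    rw [Matrix.mul_assoc (Xᴴ * G) X, hxP]
  refine ⟨Xᴴ * G * W, 1 - Xᴴ * G * X, ?_, ?_, ?_⟩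
  · rw [← Matrix.mul_assoc, ← Matrix.mul_assoc, hw]
  · rw [Matrix.mul_sub, Matrix.mul_one, hxP, sub_self]
  · have h1 : (Xᴴ * G * W) * (Xᴴ * G * W)ᴴ = Xᴴ * G * X := by
      calc (Xᴴ * G * W) * (Xᴴ * G * W)ᴴ = Xᴴ * G * (W * Wᴴ) * (G * X) := by
            simp only [conjTranspose_mul, conjTranspose_conjTranspose, hG, Matrix.mul_assoc]
        _ = (Xᴴ * G * X) * (Xᴴ * G * X) := by rw [← h]; simp only [Matrix.mul_assoc]
        _ = _ := hPP
    rw [h1, conjTranspose_sub, hP, conjTranspose_one, mul_sub, sub_mul, sub_mul, hPP]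
    simp

theorem aux_outer {d ι : Type*} [Fintype ι] (N : Matrix d ι ℂ) :
    N * Nᴴ = ∑ t, outer (fun a => N a t) := by
  ext a b
  simp [Matrix.mul_apply, outer, Matrix.sum_apply]

theorem aux_SNle {m n k : ℕ} {ι : Type*} [Fintype ι] (N : Matrix (Fin m × Fin n) ι ℂ)
    (h : ∀ t, schmidtRank (fun a => N a t) ≤ k) : SNle (N * Nᴴ) k := by
  refine ⟨Fintype.card ι, fun t a => N a ((Fintype.equivFin ι).symm t), fun t => h _, ?_⟩
  rw [aux_outer]
  exact ((Fintype.equivFin ι).symm.sum_comp (fun t => outer (fun a => N a t))).symm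

/-- drop the last row index -/
def auxI (m n : ℕ) : Fin m × Fin n → Fin (m + 1) × Fin n := Prod.map Fin.castSucc id

theorem aux_rank_add {m n : ℕ} (A B : Matrix (Fin m) (Fin n) ℂ) :
    (A + B).rank ≤ A.rank + B.rank := by
  unfold Matrix.rank
  refine le_trans (Submodule.finrank_mono ?_) (Submodule.finrank_add_le_finrank_add_finrank _ _)
  rw [Matrix.mulVecLin_add]
  rintro _ ⟨x, rfl⟩
  exact Submodule.add_mem_sup ⟨x, rfl⟩ ⟨x, rfl⟩

theorem aux_rank {m n : ℕ} (v : Fin (m + 1) × Fin n → ℂ) :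
    schmidtRank v ≤ schmidtRank (v ∘ auxI m n) + 1 := by
  unfold schmidtRank
  set M : Matrix (Fin (m+1)) (Fin n) ℂ := Matrix.of fun i j => v (i, j) with hM
  set M' : Matrix (Fin m) (Fin n) ℂ := Matrix.of fun i j => (v ∘ auxI m n) (i, j) with hM'
  have key : M = (Matrix.of fun i j => if i = Fin.castSucc j then 1 else 0 :
      Matrix (Fin (m + 1)) (Fin m) ℂ) * M' +
      vecMulVec (Pi.single (Fin.last m) 1) (fun j => v (Fin.last m, j)) := by
    ext i j
    simp only [Matrix.add_apply, Matrix.mul_apply, vecMulVec_apply, Matrix.of_apply, hM, hM']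
    refine Fin.lastCases ?_ (fun i => ?_) i
    · have : ∀ x : Fin m, ¬ (Fin.last m = Fin.castSucc x) := fun x => (Fin.castSucc_lt_last x).ne'
      simp [this]
    · have : ¬ (Fin.castSucc i = Fin.last m) := (Fin.castSucc_lt_last i).ne
      simp [this, auxI, Pi.single_apply]
  rw [key]
  refine (aux_rank_add _ _).trans (add_le_add (Matrix.rank_mul_le_right _ _) ?_)
  exact Matrix.rank_vecMulVec_le _ _

theorem aux_rank_zero {m n : ℕ} (v : Fin m × Fin n → ℂ) (h : v = 0) : schmidtRank v = 0 := by
  subst h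
  exact Matrix.rank_zero

open scoped MatrixOrder Matrix.Norms.L2Operator in
theorem aux_ext {m n r : ℕ} (ρ : Matrix (Fin (m+1) × Fin n) (Fin (m+1) × Fin n) ℂ)
    (hρ : ρ.PosSemidef) (h : SNle (ρ.submatrix (auxI m n) (auxI m n)) r) : SNle ρ (r + 1) := by
  obtain ⟨T, w, hw, hs⟩ := h
  obtain ⟨C, hC⟩ := CStarAlgebra.nonneg_iff_eq_star_mul_self.mp hρ.nonneg
  set M := Cᴴ with hM
  have hC : ρ = M * Mᴴ := by rw [hC, hM, conjTranspose_conjTranspose, star_eq_conjTranspose]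
  set W : Matrix (Fin m × Fin n) (Fin T) ℂ := Matrix.of fun a t => w t a with hW
  have hXW : M.submatrix (auxI m n) id * (M.submatrix (auxI m n) id)ᴴ = W * Wᴴ := by
    rw [aux_outer W]
    refine Eq.trans ?_ hs
    rw [hC]
    ext a b
    simp [Matrix.mul_apply]
  obtain ⟨V, Q, h1, h2, h3⟩ := aux_freedom _ _ hXW
  have hN : ρ = fromCols (M * V) (M * Q) * (fromCols (M * V) (M * Q))ᴴ := by
    rw [conjTranspose_fromCols_eq_fromRows_conjTranspose, fromCols_mul_fromRows, hC]
    calc M * Mᴴ = M * (V * Vᴴ + Q * Qᴴ) * Mᴴ := by rw [h3, mul_one]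
      _ = _ := by simp only [conjTranspose_mul, Matrix.mul_assoc, Matrix.mul_add, Matrix.add_mul]
  rw [hN]
  apply aux_SNle
  rintro (t | t)
  · refine (aux_rank _).trans ?_
    have : (fun a => fromCols (M * V) (M * Q) a (Sum.inl t)) ∘ auxI m n = w t := by
      ext a
      have := congrFun (congrFun h1 a) t
      simpa [Matrix.mul_apply, hW] using this
    rw [this]
    exact Nat.add_le_add_right (hw t) 1
  · refine (aux_rank _).trans ?_
    rw [aux_rank_zero]
    · omega
    · ext a
      have := congrFun (congrFun h2 a) t
      simpa [Matrix.mul_apply] using this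

def auxR {n m' m : ℕ} (ρ' : Matrix (Fin m' × Fin n) (Fin m' × Fin n) ℂ)
    (ρ : Matrix (Fin m × Fin n) (Fin m × Fin n) ℂ) : Prop :=
  m' ≤ m ∧ ∃ A : Matrix (Fin m') (Fin m) ℂ, A * Aᴴ = 1 ∧
    ρ' = (A ⊗ₖ (1 : Matrix (Fin n) (Fin n) ℂ)) * ρ * (A ⊗ₖ (1 : Matrix (Fin n) (Fin n) ℂ))ᴴ

theorem auxR_trans {n a b c : ℕ} {x : Matrix (Fin a × Fin n) (Fin a × Fin n) ℂ}
    {y : Matrix (Fin b × Fin n) (Fin b × Fin n) ℂ} {z : Matrix (Fin c × Fin n) (Fin c × Fin n) ℂ}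
    (h1 : auxR x y) (h2 : auxR y z) : auxR x z := by
  obtain ⟨hab, A, hA, rfl⟩ := h1
  obtain ⟨hbc, B, hB, rfl⟩ := h2
  refine ⟨hab.trans hbc, A * B, ?_, ?_⟩
  · rw [conjTranspose_mul, Matrix.mul_assoc, ← Matrix.mul_assoc B, hB, Matrix.one_mul, hA]
  · have : (A * B) ⊗ₖ (1 : Matrix (Fin n) (Fin n) ℂ) = 
      (A ⊗ₖ (1 : Matrix (Fin n) (Fin n) ℂ)) * (B ⊗ₖ (1 : Matrix (Fin n) (Fin n) ℂ)) := by
      rw [← mul_kronecker_mul, Matrix.one_mul]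
    rw [this, conjTranspose_mul]
    simp only [Matrix.mul_assoc]

theorem auxR_sub {n m : ℕ} (ρ : Matrix (Fin (m+1) × Fin n) (Fin (m+1) × Fin n) ℂ) :
    auxR (ρ.submatrix (auxI m n) (auxI m n)) ρ := by
  refine ⟨Nat.le_succ m, (1 : Matrix (Fin (m+1)) (Fin (m+1)) ℂ).submatrix Fin.castSucc id, ?_, ?_⟩
  · ext i j
    simp [Matrix.mul_apply, Matrix.one_apply]
  · have : ((1 : Matrix (Fin (m+1)) (Fin (m+1)) ℂ).submatrix Fin.castSucc id) ⊗ₖ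
        (1 : Matrix (Fin n) (Fin n) ℂ) =
        (1 : Matrix (Fin (m+1) × Fin n) (Fin (m+1) × Fin n) ℂ).submatrix (auxI m n) id := by
      rw [← one_kronecker_one]
      rfl
    rw [this, conjTranspose_submatrix, conjTranspose_one]
    ext a b
    simp [Matrix.mul_apply, Matrix.one_apply]

theorem aux_step (n r : ℕ) : ∀ (m : ℕ) (ρ : Matrix (Fin m × Fin n) (Fin m × Fin n) ℂ),
    ρ.PosSemidef → ¬ SNle ρ (r + 1) →
    ∃ (m' : ℕ) (ρ' : Matrix (Fin m' × Fin n) (Fin m' × Fin n) ℂ),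
      auxR ρ' ρ ∧ ρ'.PosSemidef ∧ SNle ρ' (r + 1) ∧ ¬ SNle ρ' r := by
  intro m
  induction m with
  | zero =>
    intro ρ _ h
    refine absurd ⟨0, fun _ => 0, fun t => t.elim0, ?_⟩ h
    ext a
    exact a.1.elim0
  | succ m ih =>
    intro ρ hρ h
    have hps := hρ.submatrix (auxI m n)
    by_cases hs : SNle (ρ.submatrix (auxI m n) (auxI m n)) (r + 1)
    · exact ⟨m, _, auxR_sub ρ, hps, hs, fun h' => h (aux_ext ρ hρ h')⟩
    · obtain ⟨m', ρ', hR, hrest⟩ := ih _ hps hs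
      exact ⟨m', ρ', auxR_trans hR (auxR_sub ρ), hrest⟩

theorem aux_chain (n k : ℕ) : ∀ (m : ℕ) (ρ : Matrix (Fin m × Fin n) (Fin m × Fin n) ℂ),
    ρ.PosSemidef → SNle ρ (k + 1) → (2 ≤ k + 1 → ¬ SNle ρ k) →
    ∃ s : ℕ → Σ m : ℕ, Matrix (Fin m × Fin n) (Fin m × Fin n) ℂ,
      s (k + 1) = ⟨m, ρ⟩ ∧
      (∀ i, 1 ≤ i → i ≤ k + 1 → (s i).2.PosSemidef ∧ SNle (s i).2 i ∧
        (2 ≤ i → ¬ SNle (s i).2 (i - 1))) ∧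
      (∀ i, 1 ≤ i → i < k + 1 → auxR (s i).2 (s (i + 1)).2) := by
  induction k with
  | zero =>
    intro m ρ h1 h2 h3
    refine ⟨fun _ => ⟨m, ρ⟩, rfl, fun i hi hi' => ?_, fun i hi hi' => by omega⟩
    obtain rfl : i = 1 := by omega
    exact ⟨h1, h2, fun h => by omega⟩
  | succ k ih =>
    intro m ρ h1 h2 h3
    obtain ⟨m', ρ', hR, hp, ha, hb⟩ := aux_step n k m ρ h1 (h3 (by omega))
    obtain ⟨s, hs, hs1, hs2⟩ := ih m' ρ' hp ha (fun _ => hb)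
    refine ⟨fun i => if i ≤ k + 1 then s i else ⟨m, ρ⟩, by simp, fun i hi hi' => ?_,
      fun i hi hi' => ?_⟩
    · by_cases h : i ≤ k + 1
      · beta_reduce
        rw [if_pos h]
        exact hs1 i hi h
      · obtain rfl : i = k + 1 + 1 := by omega
        beta_reduce
        rw [if_neg h]
        exact ⟨h1, h2, h3⟩
    · by_cases h : i < k + 1
      · have e1 : i ≤ k + 1 := h.le
        have e2 : i + 1 ≤ k + 1 := h
        beta_reduce
        rw [if_pos e1, if_pos e2]
        exact hs2 i hi h
      · obtain rfl : i = k + 1 := by omega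
        have e2 : ¬ (k + 1 + 1 ≤ k + 1) := by omega
        beta_reduce
        rw [if_pos (le_refl (k + 1)), if_neg e2, hs]
        exact hR

/-- Every Schmidt number `k` state is the local extension of a Schmidt number `k-1`
state, down to a separable state: there is a nested chain of local projections. -/
theorem schmidt_number_nested_chain {m n k : ℕ} (hk : 1 ≤ k)
    (ρ : Matrix (Fin m × Fin n) (Fin m × Fin n) ℂ) (hρ : ρ.PosSemidef)
    (hSN : SNle ρ k) (hSN' : 2 ≤ k → ¬ SNle ρ (k - 1)) :
    ∃ (ms ns : ℕ → ℕ)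
      (ρs : ∀ i, Matrix (Fin (ms i) × Fin (ns i)) (Fin (ms i) × Fin (ns i)) ℂ),
      (∀ i, 1 ≤ i → i < k → ms i ≤ ms (i + 1) ∧ ns i ≤ ns (i + 1)) ∧
      ms k = m ∧ ns k = n ∧ HEq (ρs k) ρ ∧
      (∀ i, 1 ≤ i → i ≤ k →
        (ρs i).PosSemidef ∧ SNle (ρs i) i ∧ (2 ≤ i → ¬ SNle (ρs i) (i - 1))) ∧
      (∀ i, 1 ≤ i → i < k →
        ∃ (A : Matrix (Fin (ms i)) (Fin (ms (i + 1))) ℂ)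
          (B : Matrix (Fin (ns i)) (Fin (ns (i + 1))) ℂ),
          A * A.conjTranspose = 1 ∧ B * B.conjTranspose = 1 ∧
          ρs i = (A ⊗ₖ B) * ρs (i + 1) * (A ⊗ₖ B).conjTranspose) := by
  obtain ⟨k, rfl⟩ : ∃ j, k = j + 1 := ⟨k - 1, by omega⟩
  obtain ⟨s, hs, hs1, hs2⟩ := aux_chain n k m ρ hρ hSN hSN'
  refine ⟨fun i => (s i).1, fun _ => n, fun i => (s i).2, fun i hi hi' => ⟨(hs2 i hi hi').1, le_rfl⟩,
    ?_, rfl, ?_, hs1, fun i hi hi' => ?_⟩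
  · simp only [hs]
  · simp only []
    rw [hs]
  · obtain ⟨_, A, hA, h⟩ := hs2 i hi hi'
    exact ⟨A, 1, hA, by simp, h⟩
end
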